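/- arXiv:2202.05471 — 4 statements merged into one kernel-verified Lean document; each statement's English description precedes it below -/
import Mathlib

section
/- Let f : D → D be a C²-smooth map such that for every complete geodesic γ of (D, ρ) (i.e., every map γ : ℝ → D with ρ(γ(s), γ(t)) = c|s − t| for all s, t ∈ ℝ and some constant c > 0), the composition f ∘ γ is again a complete geodesic of (D, ρ) with some (possibly different) positive constant speed. Suppose f extends C¹-smoothly to D ∪ U for some nonempty open arc U ⊂ ∂D, and the radial derivative of f is nonzero at every point of U. Then either f is a Möbius automorphism of D, or the complex conjugate of f is a Möbius automorphism of D. -/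
open Complex Metric Set Filter

noncomputable section

/-- The open unit disc in `ℂ`. -/
def unitDisc : Set ℂ := {z : ℂ | ‖z‖ < 1}

/-- The unit circle, the boundary of the unit disc. -/
def unitCircle : Set ℂ := {z : ℂ | ‖z‖ = 1}

/-- Inverse hyperbolic tangent. -/
def artanh (x : ℝ) : ℝ := Real.log ((1 + x) / (1 - x)) / 2

/-- The Poincaré distance on the unit disc. -/
def pdist (z w : ℂ) : ℝ := artanh ‖(z - w) / (1 - (starRingEnd ℂ) w * z)‖

/-- `f` agrees on the unit disc with a Möbius automorphism
`z ↦ e^{iθ}(z - a)/(1 - conj(a) z)` of the disc. -/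
def IsMobiusOn (f : ℂ → ℂ) : Prop :=
  ∃ (θ : ℝ) (a : ℂ), ‖a‖ < 1 ∧
    ∀ z ∈ unitDisc, f z = Complex.exp (θ * Complex.I) * ((z - a) / (1 - (starRingEnd ℂ) a * z))


lemma hyp_mid (X0 X1 X2 Y0 Y1 Y2 M0 M1 M2 C : ℝ)
    (hX : X0 ^ 2 = 1 + X1 ^ 2 + X2 ^ 2) (hY : Y0 ^ 2 = 1 + Y1 ^ 2 + Y2 ^ 2)
    (hM : M0 ^ 2 = 1 + M1 ^ 2 + M2 ^ 2)
    (h1 : X0 * M0 - X1 * M1 - X2 * M2 = C) (h2 : Y0 * M0 - Y1 * M1 - Y2 * M2 = C)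
    (h3 : X0 * Y0 - X1 * Y1 - X2 * Y2 = 2 * C ^ 2 - 1) :
    X0 + Y0 = 2 * C * M0 ∧ X1 + Y1 = 2 * C * M1 ∧ X2 + Y2 = 2 * C * M2 := by
  obtain ⟨v0, hv0⟩ : ∃ v, v = X0 + Y0 - 2 * C * M0 := ⟨_, rfl⟩
  obtain ⟨v1, hv1⟩ : ∃ v, v = X1 + Y1 - 2 * C * M1 := ⟨_, rfl⟩
  obtain ⟨v2, hv2⟩ : ∃ v, v = X2 + Y2 - 2 * C * M2 := ⟨_, rfl⟩
  have e1 : v0 * M0 = v1 * M1 + v2 * M2 := by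
    rw [hv0, hv1, hv2]; linear_combination h1 + h2 - 2 * C * hM
  have e2 : v0 ^ 2 = v1 ^ 2 + v2 ^ 2 := by
    rw [hv0, hv1, hv2]
    linear_combination hX + hY + 2 * h3 - 4 * C * h1 - 4 * C * h2 + 4 * C ^ 2 * hM
  have e3 : v0 ^ 2 + (v1 * M2 - v2 * M1) ^ 2 = 0 := by
    linear_combination -v0^2*hM + (v0 * M0 + v1 * M1 + v2 * M2) * e1 -(M1^2+M2^2) * e2
  have z0 : v0 = 0 := by nlinarith [sq_nonneg v0, sq_nonneg (v1 * M2 - v2 * M1)]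
  have z1 : v1 = 0 := by rw [z0] at e2; nlinarith [sq_nonneg v1, sq_nonneg v2]
  have z2 : v2 = 0 := by rw [z0] at e2; nlinarith [sq_nonneg v1, sq_nonneg v2]
  refine ⟨by linarith, by linarith, by linarith⟩

/-- squared sinh of the distance -/
def sdist (z w : ℂ) : ℝ := normSq (z - w) / ((1 - normSq z) * (1 - normSq w))

lemma mem_disc {z : ℂ} : z ∈ unitDisc ↔ normSq z < 1 := by
  rw [normSq_eq_norm_sq]
  show ‖z‖ < 1 ↔ _
  constructor
  · intro h; nlinarith [norm_nonneg z]
  · intro h; nlinarith [norm_nonneg z]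

lemma den_pos {z w : ℂ} (hz : z ∈ unitDisc) (hw : w ∈ unitDisc) :
    0 < normSq (1 - (starRingEnd ℂ) w * z) := by
  rw [normSq_pos]
  intro h
  have h1 : ‖(starRingEnd ℂ) w * z‖ = 1 := by rw [← sub_eq_zero.1 h]; simp
  rw [norm_mul, RCLike.norm_conj] at h1
  have a : ‖z‖ < 1 := hz
  have b : ‖w‖ < 1 := hw
  nlinarith [norm_nonneg z, norm_nonneg w]

lemma den_id (z w : ℂ) : normSq (1 - (starRingEnd ℂ) w * z) =
    normSq (z - w) + (1 - normSq z) * (1 - normSq w) := by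
  simp only [normSq_apply, sub_re, sub_im, mul_re, mul_im, conj_re, conj_im, one_re, one_im]
  ring

lemma pdist_spec {z w : ℂ} (hz : z ∈ unitDisc) (hw : w ∈ unitDisc) :
    0 ≤ pdist z w ∧ Real.sinh (pdist z w) ^ 2 = sdist z w := by
  have hd := den_pos hz hw
  have hz' := mem_disc.1 hz
  have hw' := mem_disc.1 hw
  obtain ⟨r, hr⟩ : ∃ r, r = ‖(z - w) / (1 - (starRingEnd ℂ) w * z)‖ := ⟨_, rfl⟩
  have r0 : 0 ≤ r := hr ▸ norm_nonneg _
  have r2 : r ^ 2 = normSq (z - w) / normSq (1 - (starRingEnd ℂ) w * z) := by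
    rw [hr, ← normSq_eq_norm_sq, normSq_div]
  have hp : 0 < (1 - normSq z) * (1 - normSq w) := mul_pos (by linarith) (by linarith)
  have r1 : r ^ 2 < 1 := by
    rw [r2, div_lt_one hd, den_id]; linarith
  have r1' : r < 1 := by nlinarith
  have hS : sdist z w = r ^ 2 / (1 - r ^ 2) := by
    rw [r2, sdist, one_sub_div hd.ne', div_div_div_cancel_right₀ hd.ne', den_id]; congr 1; ring
  have hpd : pdist z w = Real.log ((1 + r) / (1 - r)) / 2 := by rw [pdist, artanh, hr]
  have hq : 1 ≤ (1 + r) / (1 - r) := by rw [le_div_iff₀ (by linarith)]; linarith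
  refine ⟨by rw [hpd]; have := Real.log_nonneg hq; linarith, ?_⟩
  have h2 : Real.cosh (2 * pdist z w) = ((1 + r) / (1 - r) + ((1 + r) / (1 - r))⁻¹) / 2 := by
    rw [hpd, mul_div_cancel₀ _ (two_ne_zero), Real.cosh_log (by linarith)]
  rw [Real.cosh_two_mul, Real.cosh_sq] at h2
  have : Real.sinh (pdist z w) ^ 2 = (((1 + r) / (1 - r) + ((1 + r) / (1 - r))⁻¹) / 2 - 1) / 2 := by
    linarith
  rw [this, hS]
  have a1 : 1 - r ≠ 0 := by linarith
  have a2 : 1 + r ≠ 0 := by linarith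
  have a3 : 1 - r ^ 2 ≠ 0 := by linarith
  have a4 : (1 - r) * (1 + r) ≠ 0 := mul_ne_zero a1 a2
  field_simp
  ring_nf

lemma pdist_iff {z w : ℂ} (hz : z ∈ unitDisc) (hw : w ∈ unitDisc) (d : ℝ) :
    pdist z w = |d| ↔ sdist z w = Real.sinh d ^ 2 := by
  obtain ⟨h0, h1⟩ := pdist_spec hz hw
  have h2 : Real.sinh d ^ 2 = Real.sinh |d| ^ 2 := by
    rcases abs_choice d with h | h <;> rw [h]
    rw [Real.sinh_neg, neg_sq]
  rw [← h1, h2, sq_eq_sq₀ (Real.sinh_nonneg_iff.2 h0) (Real.sinh_nonneg_iff.2 (abs_nonneg d))]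
  exact Real.sinh_injective.eq_iff.symm

/-- translation -/
def mob (a z : ℂ) : ℂ := (z + a) / (1 + (starRingEnd ℂ) a * z)

lemma neg_mem_disc {a : ℂ} (ha : a ∈ unitDisc) : -a ∈ unitDisc := by
  rw [mem_disc] at *; simpa using ha

lemma mob_den {a z : ℂ} (ha : a ∈ unitDisc) (hz : z ∈ unitDisc) :
    1 + (starRingEnd ℂ) a * z ≠ 0 := by
  have := den_pos hz (neg_mem_disc ha)
  rw [normSq_pos] at this
  simpa using this

lemma mob_id {a z : ℂ} (ha : a ∈ unitDisc) (hz : z ∈ unitDisc) :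
    1 - normSq (mob a z) = (1 - normSq a) * (1 - normSq z) / normSq (1 + (starRingEnd ℂ) a * z) := by
  have h := normSq_pos.2 (mob_den ha hz)
  rw [mob, normSq_div, one_sub_div h.ne']
  congr 1
  simp only [normSq_apply, add_re, add_im, mul_re, mul_im, conj_re, conj_im, one_re, one_im]
  ring

lemma mob_mem {a z : ℂ} (ha : a ∈ unitDisc) (hz : z ∈ unitDisc) : mob a z ∈ unitDisc := by
  have h := normSq_pos.2 (mob_den ha hz)
  have h1 := mob_id ha hz
  rw [mem_disc] at *
  have : 0 < (1 - normSq a) * (1 - normSq z) / normSq (1 + (starRingEnd ℂ) a * z) :=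
    div_pos (mul_pos (by linarith) (by linarith)) h
  linarith

lemma mob_sdist {a z w : ℂ} (ha : a ∈ unitDisc) (hz : z ∈ unitDisc) (hw : w ∈ unitDisc) :
    sdist (mob a z) (mob a w) = sdist z w := by
  have h1 := mob_den ha hz
  have h2 := mob_den ha hw
  have e : mob a z - mob a w = (1 - (normSq a : ℂ)) * (z - w) /
      ((1 + (starRingEnd ℂ) a * z) * (1 + (starRingEnd ℂ) a * w)) := by
    rw [mob, mob, div_sub_div _ _ h1 h2, normSq_eq_conj_mul_self]; congr 1; ring
  have e2 : normSq (1 - (normSq a : ℂ)) = (1 - normSq a) ^ 2 := by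
    have : (1 - (normSq a : ℂ)) = ((1 - normSq a : ℝ) : ℂ) := by push_cast; ring
    rw [this, normSq_ofReal]; ring
  have n1 := (normSq_pos.2 h1).ne'
  have n2 := (normSq_pos.2 h2).ne'
  rw [sdist, sdist, mob_id ha hz, mob_id ha hw, e, normSq_div, normSq_mul, normSq_mul, e2]
  generalize normSq (1 + (starRingEnd ℂ) a * z) = N1 at *
  generalize normSq (1 + (starRingEnd ℂ) a * w) = N2 at *
  rw [mem_disc] at ha hz hw
  have n3 : 1 - normSq a ≠ 0 := by linarith
  have n4 : 1 - normSq z ≠ 0 := by linarith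
  have n5 : 1 - normSq w ≠ 0 := by linarith
  field_simp

lemma mob_mob {a z : ℂ} (ha : a ∈ unitDisc) (hz : z ∈ unitDisc) : mob a (mob (-a) z) = z := by
  have h1 := mob_den (neg_mem_disc ha) hz
  have h2 := mob_den ha (mob_mem (neg_mem_disc ha) hz)
  have h3 : (1 - (normSq a : ℂ)) ≠ 0 := by
    have : (1 - (normSq a : ℂ)) = ((1 - normSq a : ℝ) : ℂ) := by push_cast; ring
    rw [this, ofReal_ne_zero]
    rw [mem_disc] at ha; linarith
  rw [normSq_eq_conj_mul_self] at h3
  rw [mob, div_eq_iff h2, mob]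
  have h4 : 1 - z * (starRingEnd ℂ) a ≠ 0 := by
    convert h1 using 1
    rw [map_neg]; ring
  simp only [map_neg]
  have h5 : 1 + -(starRingEnd ℂ) a * z = 1 - z * (starRingEnd ℂ) a := by ring
  rw [h5]
  field_simp
  ring

lemma mid_of {x y m : ℂ} (hx : x ∈ unitDisc) (hy : y ∈ unitDisc) (hm : m ∈ unitDisc) (d : ℝ)
    (h1 : sdist x m = Real.sinh d ^ 2) (h2 : sdist y m = Real.sinh d ^ 2)
    (h3 : sdist x y = Real.sinh (2 * d) ^ 2) :
    ∃ k : ℝ, 0 < k ∧ ((1 - normSq x)⁻¹ : ℝ) * x + ((1 - normSq y)⁻¹ : ℝ) * y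
        = ((k * (1 - normSq m)⁻¹ : ℝ) : ℂ) * m ∧
      (1 + normSq x) / (1 - normSq x) + (1 + normSq y) / (1 - normSq y)
        = k * ((1 + normSq m) / (1 - normSq m)) := by
  have key : ∀ z w : ℂ, z ∈ unitDisc → w ∈ unitDisc → 
     ((1 + normSq z) / (1 - normSq z)) * ((1 + normSq w) / (1 - normSq w)) -
     (2 * z.re / (1 - normSq z)) * (2 * w.re / (1 - normSq w)) -
     (2 * z.im / (1 - normSq z)) * (2 * w.im / (1 - normSq w)) = 1 + 2 * sdist z w := by
    intro z w hz hw
    rw [mem_disc] at hz hw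
    have n4 : 1 - normSq z ≠ 0 := by linarith
    have n5 : 1 - normSq w ≠ 0 := by linarith
    rw [sdist]
    field_simp
    simp only [normSq_apply, sub_re, sub_im]
    ring
  have key2 : ∀ z : ℂ, z ∈ unitDisc → ((1 + normSq z) / (1 - normSq z)) ^ 2 =
     1 + (2 * z.re / (1 - normSq z)) ^ 2 + (2 * z.im / (1 - normSq z)) ^ 2 := by
    intro z hz
    have := key z z hz hz
    simp only [sdist, sub_self, map_zero, zero_div] at this
    linarith
  have hC : 1 + 2 * Real.sinh d ^ 2 = Real.cosh (2 * d) := by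
    rw [Real.cosh_two_mul, Real.cosh_sq]; ring
  obtain ⟨a0, a1, a2⟩ := hyp_mid _ _ _ _ _ _ _ _ _ (Real.cosh (2 * d)) (key2 x hx) (key2 y hy) (key2 m hm)
    (by rw [key x m hx hm, h1, hC]) (by rw [key y m hy hm, h2, hC])
    (by rw [key x y hx hy, h3, Real.cosh_sq]; ring)
  refine ⟨2 * Real.cosh (2 * d), by have := Real.cosh_pos (2 * d); linarith, ?_, a0⟩
  apply Complex.ext
  · simp only [add_re, re_ofReal_mul]
    simp only [div_eq_mul_inv] at a1
    linarith
  · simp only [add_im, im_ofReal_mul]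
    simp only [div_eq_mul_inv] at a2
    linarith

/-- polar point -/
def pol (t : ℝ) (u : ℂ) : ℂ := (Real.tanh t : ℂ) * u

lemma tanh_cosh (t : ℝ) : Real.tanh t * Real.cosh t = Real.sinh t := by
  rw [Real.tanh_eq_sinh_div_cosh, div_mul_cancel₀ _ (Real.cosh_pos t).ne']

lemma one_sub_tanh (t : ℝ) : 1 - Real.tanh t ^ 2 = (Real.cosh t ^ 2)⁻¹ := by
  have := (Real.cosh_pos t).ne'
  rw [Real.tanh_eq_sinh_div_cosh]
  field_simp
  rw [Real.cosh_sq]; ring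

lemma tanh_inj' {a b : ℝ} (h : Real.tanh a = Real.tanh b) : a = b := by
  rw [← Real.artanh_tanh a, h, Real.artanh_tanh]

lemma tanh_pos' {a : ℝ} (h : 0 < a) : 0 < Real.tanh a := by
  rw [Real.tanh_eq_sinh_div_cosh]
  exact div_pos (Real.sinh_pos_iff.2 h) (Real.cosh_pos a)

lemma normSq_pol (t : ℝ) {u : ℂ} (hu : normSq u = 1) : normSq (pol t u) = Real.tanh t ^ 2 := by
  rw [pol, normSq_mul, normSq_ofReal, hu]; ring

lemma pol_mem (t : ℝ) {u : ℂ} (hu : normSq u = 1) : pol t u ∈ unitDisc := by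
  rw [mem_disc, normSq_pol t hu]; exact Real.tanh_sq_lt_one t

lemma pol_inv (t : ℝ) {u : ℂ} (hu : normSq u = 1) : (1 - normSq (pol t u))⁻¹ = Real.cosh t ^ 2 := by
  rw [normSq_pol t hu, one_sub_tanh, inv_inv]

lemma pol_space (t : ℝ) {u : ℂ} (hu : normSq u = 1) (k : ℝ) :
    (((k * (1 - normSq (pol t u))⁻¹ : ℝ)) : ℂ) * pol t u
      = ((k * (Real.sinh (2 * t) / 2) : ℝ) : ℂ) * u := by
  rw [pol_inv t hu, pol, ← mul_assoc, ← ofReal_mul]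
  congr 2
  rw [Real.sinh_two_mul, ← tanh_cosh]; ring

lemma pol_space' (t : ℝ) {u : ℂ} (hu : normSq u = 1) :
    (((1 - normSq (pol t u))⁻¹ : ℝ) : ℂ) * pol t u
      = ((Real.sinh (2 * t) / 2 : ℝ) : ℂ) * u := by
  have := pol_space t hu 1
  simpa only [one_mul] using this

lemma pol_time (t : ℝ) {u : ℂ} (hu : normSq u = 1) :
    (1 + normSq (pol t u)) / (1 - normSq (pol t u)) = Real.cosh (2 * t) := by
  rw [div_eq_mul_inv, pol_inv t hu, normSq_pol t hu, Real.cosh_two_mul, ← tanh_cosh]; ring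

lemma pol_sdist (s t : ℝ) {u v : ℂ} (hu : normSq u = 1) (hv : normSq v = 1) :
    sdist (pol s u) (pol t v) = (Real.sinh s * Real.cosh t) ^ 2 + (Real.sinh t * Real.cosh s) ^ 2
      - 2 * (Real.sinh s * Real.cosh t) * (Real.sinh t * Real.cosh s) * (u.re * v.re + u.im * v.im) := by
  rw [sdist, div_eq_mul_inv, mul_inv, pol_inv s hu, pol_inv t hv, ← tanh_cosh, ← tanh_cosh]
  rw [normSq_apply] at hu hv
  simp only [pol, normSq_apply, sub_re, sub_im, re_ofReal_mul, im_ofReal_mul]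
  linear_combination (Real.cosh s ^ 2 * Real.cosh t ^ 2) * (Real.tanh s ^ 2 * hu + Real.tanh t ^ 2 * hv)

lemma pol_sdist_same (s t : ℝ) {u : ℂ} (hu : normSq u = 1) :
    sdist (pol s u) (pol t u) = Real.sinh (s - t) ^ 2 := by
  rw [pol_sdist s t hu hu, Real.sinh_sub]
  rw [normSq_apply] at hu
  rw [hu]; ring

lemma pol_dir {s t : ℝ} (hs : 0 < s) (ht : 0 < t) {u v : ℂ} (hu : normSq u = 1) (hv : normSq v = 1)
    (h : sdist (pol s u) (pol t v) = Real.sinh (s - t) ^ 2) : u = v := by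
  rw [pol_sdist s t hu hv, Real.sinh_sub] at h
  have hp : 0 < 2 * (Real.sinh s * Real.cosh t) * (Real.sinh t * Real.cosh s) := by
    have := Real.sinh_pos_iff.2 hs
    have := Real.sinh_pos_iff.2 ht
    have := Real.cosh_pos s
    have := Real.cosh_pos t
    positivity
  have h1 : u.re * v.re + u.im * v.im = 1 := by
    apply mul_left_cancel₀ hp.ne'
    linarith
  have h2 : normSq (u - v) = 0 := by
    rw [normSq_apply] at *
    simp only [sub_re, sub_im]
    linarith
  exact sub_eq_zero.1 (normSq_eq_zero.1 h2)

lemma pol_zero (u : ℂ) : pol 0 u = 0 := by simp [pol]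

lemma exists_pol {z : ℂ} (hz : z ∈ unitDisc) (h0 : z ≠ 0) :
    ∃ t u σ, 0 < t ∧ normSq u = 1 ∧ z = pol t u ∧ 0 < σ ∧ u = (σ : ℝ) * z := by
  have hn : 0 < ‖z‖ := norm_pos_iff.2 h0
  have h1 : ‖z‖ < 1 := hz
  refine ⟨Real.artanh ‖z‖, ((‖z‖⁻¹ : ℝ) : ℂ) * z, ‖z‖⁻¹, Real.artanh_pos ⟨hn, h1⟩, ?_, ?_, by positivity, rfl⟩
  · rw [normSq_eq_norm_sq, norm_mul, Complex.norm_real, norm_inv, norm_norm, inv_mul_cancel₀ hn.ne']; norm_num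
  · rw [pol, Real.tanh_artanh ⟨by linarith, h1⟩, ← mul_assoc, ← ofReal_mul, mul_inv_cancel₀ hn.ne']; simp

lemma exists_pol' {z : ℂ} (hz : z ∈ unitDisc) : ∃ t u, normSq u = 1 ∧ z = pol t u := by
  by_cases h : z = 0
  · exact ⟨0, 1, by simp, by rw [h, pol_zero]⟩
  · obtain ⟨t, u, _, _, h1, h2, _⟩ := exists_pol hz h
    exact ⟨t, u, h1, h2⟩

lemma zero_mem_disc : (0 : ℂ) ∈ unitDisc := by rw [mem_disc]; simp

/-- geodesic-preserving in terms of `sdist` -/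
def GeoP (g : ℂ → ℂ) : Prop :=
  ∀ γ : ℝ → ℂ, (∀ t, γ t ∈ unitDisc) → (∀ s t, sdist (γ s) (γ t) = Real.sinh (s - t) ^ 2) →
    ∃ c > 0, ∀ s t, sdist (g (γ s)) (g (γ t)) = Real.sinh (c * (s - t)) ^ 2

/-- metric midpoint -/
def Mid (x y m : ℂ) : Prop := ∃ d : ℝ, sdist x m = Real.sinh d ^ 2 ∧ sdist y m = Real.sinh d ^ 2 ∧
  sdist x y = Real.sinh (2 * d) ^ 2

lemma exists_mid {g : ℂ → ℂ} (hg : GeoP g) {x y : ℂ} (hx : x ∈ unitDisc) (hy : y ∈ unitDisc) :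
    ∃ m ∈ unitDisc, Mid x y m ∧ Mid (g x) (g y) (g m) := by
  obtain ⟨d, v, hv, e⟩ := exists_pol' (mob_mem (neg_mem_disc hx) hy)
  have e2 : mob x (pol d v) = y := by rw [← e, mob_mob hx hy]
  have e1 : mob x (pol 0 v) = x := by rw [pol_zero, mob]; simp
  have hm := fun t => mob_mem hx (pol_mem t hv)
  have hs : ∀ s t, sdist (mob x (pol s v)) (mob x (pol t v)) = Real.sinh (s - t) ^ 2 := by
    intro s t
    rw [mob_sdist hx (pol_mem s hv) (pol_mem t hv), pol_sdist_same s t hv]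
  obtain ⟨c, hc, h⟩ := hg (fun t => mob x (pol t v)) hm hs
  have sq_neg : ∀ a b : ℝ, a = -b → Real.sinh a ^ 2 = Real.sinh b ^ 2 := by
    rintro a b rfl; rw [Real.sinh_neg, neg_sq]
  refine ⟨mob x (pol (d / 2) v), hm _, ⟨d / 2, ?_, ?_, ?_⟩, ⟨c * (d / 2), ?_, ?_, ?_⟩⟩
  · have := hs 0 (d / 2)
    rw [e1] at this; rw [this]; apply sq_neg; ring
  · have := hs d (d / 2)
    rw [e2] at this; rw [this]; congr 2; ring
  · have := hs 0 d
    rw [e1, e2] at this; rw [this]; apply sq_neg; ring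
  · have := h 0 (d / 2)
    rw [e1] at this; rw [this]; apply sq_neg; ring
  · have := h d (d / 2)
    rw [e2] at this; rw [this]; congr 2; ring
  · have := h 0 d
    rw [e1, e2] at this; rw [this]; apply sq_neg; ring

lemma pol_deriv (c : ℝ) (u : ℂ) : HasDerivAt (fun t : ℝ => pol (c * t) u) ((c : ℂ) * u) 0 := by
  have h1 : HasDerivAt (fun t : ℝ => Real.tanh (c * t)) c 0 := by
    have e : (fun t : ℝ => Real.tanh (c * t)) = fun t => Real.sinh (c * t) / Real.cosh (c * t) := by
      funext t; rw [Real.tanh_eq_sinh_div_cosh]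
    rw [e]
    have hl : HasDerivAt (fun t : ℝ => c * t) c 0 := by simpa using (hasDerivAt_id (0 : ℝ)).const_mul c
    have := hl.sinh.div hl.cosh (Real.cosh_pos _).ne'
    simp only [mul_zero, Real.cosh_zero, Real.sinh_zero, one_mul, zero_mul, mul_one, sub_zero, one_pow, div_one] at this
    exact this
  exact h1.ofReal_comp.mul_const u

lemma ray {g : ℂ → ℂ} (hmap : ∀ z ∈ unitDisc, g z ∈ unitDisc) (hg : GeoP g) (h0 : g 0 = 0)
    {L : ℂ →L[ℝ] ℂ} (hL : HasFDerivAt g L 0) {u : ℂ} (hu : normSq u = 1) :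
    ∃ c v, 0 < c ∧ normSq v = 1 ∧ L u = (c : ℝ) * v ∧ ∀ t > 0, g (pol t u) = pol (c * t) v := by
  obtain ⟨c, hc, h⟩ := hg (fun t => pol t u) (fun t => pol_mem t hu) (fun s t => pol_sdist_same s t hu)
  have hdir : ∀ t > 0, ∃ v, normSq v = 1 ∧ g (pol t u) = pol (c * t) v := by
    intro t ht
    have h1 := h t 0
    have hz := hmap _ (pol_mem t hu)
    rw [pol_zero, h0, sub_zero] at h1
    obtain ⟨a, v, hv, e⟩ := exists_pol' hz
    have h2 := pol_sdist_same a 0 hv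
    rw [pol_zero, ← e, h1, sub_zero] at h2
    rcases sq_eq_sq_iff_eq_or_eq_neg.1 h2 with h3 | h3
    · exact ⟨v, hv, by rw [e, Real.sinh_injective h3]⟩
    · rw [← Real.sinh_neg] at h3
      refine ⟨-v, by rw [normSq_neg, hv], ?_⟩
      rw [e, Real.sinh_injective h3, pol, pol, Real.tanh_neg]; simp
  obtain ⟨v, hv, hv1⟩ := hdir 1 one_pos
  have hall : ∀ t > 0, g (pol t u) = pol (c * t) v := by
    intro t ht
    obtain ⟨w, hw, e⟩ := hdir t ht
    have := h t 1
    rw [e, hv1, mul_sub] at this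
    rw [e, pol_dir (by positivity) (by positivity) hw hv this]
  refine ⟨c, v, hc, hv, ?_, hall⟩
  have d1 : HasDerivAt (fun t : ℝ => g (pol t u)) (L u) 0 := by
    have hp := pol_deriv 1 u
    simp only [one_mul, ofReal_one] at hp
    have hL' : HasFDerivAt g L (pol 0 u) := by rw [pol_zero]; exact hL
    exact hL'.comp_hasDerivAt (0 : ℝ) hp
  have d2 := (pol_deriv c v).hasDerivWithinAt (s := Ici 0)
  have d3 : HasDerivWithinAt (fun t : ℝ => pol (c * t) v) (L u) (Ici 0) 0 := by
    refine (d1.hasDerivWithinAt (s := Ici 0)).congr ?_ ?_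
    · intro t ht
      rcases eq_or_lt_of_le (show (0 : ℝ) ≤ t from ht) with rfl | ht'
      · simp [pol_zero, h0]
      · exact (hall t ht').symm
    · simp [pol_zero, h0]
  exact (uniqueDiffWithinAt_Ici (0 : ℝ)).eq_deriv _ d3 d2

lemma cosh_inj' {a b : ℝ} (ha : 0 < a) (hb : 0 < b) (h : Real.cosh a = Real.cosh b) : a = b := by
  rcases lt_trichotomy a b with h1 | h1 | h1
  · have := Real.cosh_lt_cosh.2 (show |a| < |b| by rwa [abs_of_pos ha, abs_of_pos hb])
    linarith
  · exact h1
  · have := Real.cosh_lt_cosh.2 (show |b| < |a| by rwa [abs_of_pos ha, abs_of_pos hb])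
    linarith

lemma indep {u v : ℂ} (hu : normSq u = 1) (hv : normSq v = 1) (h1 : u ≠ v) (h2 : u + v ≠ 0)
    {p q : ℝ} (h : (p : ℂ) * u + (q : ℂ) * v = 0) : p = q := by
  by_contra hne
  have e : (p : ℂ) * u = -((q : ℂ) * v) := by linear_combination h
  have e2 := congrArg normSq e
  rw [normSq_neg, normSq_mul, normSq_mul, hu, hv, normSq_ofReal, normSq_ofReal] at e2
  have : (p - q) * (p + q) = 0 := by linarith
  rcases mul_eq_zero.1 this with h3 | h3
  · exact hne (by linarith)
  · have hq : q = -p := by linarith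
    have hp : (p : ℂ) ≠ 0 := by
      rw [ofReal_ne_zero]; rintro rfl; apply hne; linarith
    rw [hq, ofReal_neg] at h
    apply h1
    apply mul_left_cancel₀ hp
    linear_combination h

lemma speed_eq {g : ℂ → ℂ} (hmap : ∀ z ∈ unitDisc, g z ∈ unitDisc) (hg : GeoP g) (h0 : g 0 = 0)
    {L : ℂ →L[ℝ] ℂ} (hL : HasFDerivAt g L 0) {u v : ℂ} (hu : normSq u = 1) (hv : normSq v = 1)
    (h1 : u ≠ v) (h2 : u + v ≠ 0) : ‖L u‖ = ‖L v‖ := by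
  obtain ⟨c, u', hc, hu', hLu, hgu⟩ := ray hmap hg h0 hL hu
  obtain ⟨d, v', hd, hv', hLv, hgv⟩ := ray hmap hg h0 hL hv
  have Lsmul : ∀ (r : ℝ) (z : ℂ), L ((r : ℂ) * z) = (r : ℂ) * L z := by
    intro r z
    rw [← real_smul, map_smul, real_smul]
  have Linj : ∀ z, L z = 0 → z = 0 := by
    intro z hz
    by_contra hne
    have hn : 0 < ‖z‖ := norm_pos_iff.2 hne
    obtain ⟨b, w', hb, hw', hLw, -⟩ := ray hmap hg h0 hL (u := ((‖z‖⁻¹ : ℝ) : ℂ) * z) (by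
      rw [normSq_eq_norm_sq, norm_mul, Complex.norm_real, norm_inv, norm_norm, inv_mul_cancel₀ hn.ne']; norm_num)
    rw [Lsmul, hz, mul_zero] at hLw
    have := congrArg normSq hLw
    rw [normSq_mul, hw', normSq_ofReal, map_zero] at this
    nlinarith
  have key : ∀ t > 0, Real.sinh (2 * (c * t)) / 2 / c = Real.sinh (2 * (d * t)) / 2 / d := by
    intro t ht
    obtain ⟨m, hm, ⟨a, a1, a2, a3⟩, ⟨b, b1, b2, b3⟩⟩ := exists_mid hg (pol_mem t hu) (pol_mem t hv)
    obtain ⟨k, hk, ks, -⟩ := mid_of (pol_mem t hu) (pol_mem t hv) hm a a1 a2 a3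
    rw [hgu t ht] at b1 b3
    rw [hgv t ht] at b2 b3
    obtain ⟨k', hk', ks', -⟩ := mid_of (pol_mem _ hu') (pol_mem _ hv') (hmap _ hm) b b1 b2 b3
    rw [pol_space' _ hu, pol_space' _ hv] at ks
    rw [pol_space' _ hu', pol_space' _ hv'] at ks'
    have hst : 0 < Real.sinh (2 * t) / 2 := by
      have := Real.sinh_pos_iff.2 (show 0 < 2 * t by linarith); linarith
    have hst' : ((Real.sinh (2 * t) / 2 : ℝ) : ℂ) ≠ 0 := ofReal_ne_zero.2 hst.ne'
    have hm0 : m ≠ 0 := by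
      rintro rfl
      rw [mul_zero, ← mul_add] at ks
      rcases mul_eq_zero.1 ks with h | h
      · exact hst' h
      · exact h2 h
    obtain ⟨s, w, σ, hs, hw, hmw, hσ, hwm⟩ := exists_pol hm hm0
    obtain ⟨e, w', he, hw', hLw, hgw⟩ := ray hmap hg h0 hL hw
    have hgm : g m = pol (e * s) w' := by rw [hmw]; exact hgw s hs
    -- m is a real multiple of u + v
    have hKm : ((k * (1 - normSq m)⁻¹ : ℝ) : ℂ) ≠ 0 := by
      rw [mem_disc] at hm
      have : 0 < k * (1 - normSq m)⁻¹ := mul_pos hk (inv_pos.2 (by linarith))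
      exact ofReal_ne_zero.2 this.ne'
    obtain ⟨τ, hτ⟩ : ∃ τ : ℝ, w = (τ : ℂ) * (u + v) := by
      refine ⟨σ * ((k * (1 - normSq m)⁻¹)⁻¹ * (Real.sinh (2 * t) / 2)), ?_⟩
      rw [hwm, ofReal_mul σ, ofReal_mul _⁻¹, ofReal_inv, mul_assoc, mul_assoc, mul_add, ks, inv_mul_cancel_left₀ hKm]
    obtain ⟨κ, hκ⟩ : ∃ κ : ℝ, ((k' * (1 - normSq (g m))⁻¹ : ℝ) : ℂ) * g m = (κ : ℂ) * L (u + v) := by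
      refine ⟨(k' * (1 - normSq (g m))⁻¹) * Real.tanh (e * s) * e⁻¹ * τ, ?_⟩
      have hL2 : (τ : ℂ) * L (u + v) = e * w' := by rw [← Lsmul, ← hτ, hLw]
      have hec : (e : ℂ) ≠ 0 := ofReal_ne_zero.2 he.ne'
      rw [ofReal_mul _ τ, mul_assoc, hL2, ofReal_mul _ e⁻¹, ofReal_inv, mul_assoc, inv_mul_cancel_left₀ hec,
        ofReal_mul _ (Real.tanh _), mul_assoc]
      congr 1
    rw [hκ] at ks'
    have hcc : (c : ℂ) ≠ 0 := ofReal_ne_zero.2 hc.ne'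
    have hdc : (d : ℂ) ≠ 0 := ofReal_ne_zero.2 hd.ne'
    have hu'' : u' = ((c⁻¹ : ℝ) : ℂ) * L u := by rw [hLu, ofReal_inv, inv_mul_cancel_left₀ hcc]
    have hv'' : v' = ((d⁻¹ : ℝ) : ℂ) * L v := by rw [hLv, ofReal_inv, inv_mul_cancel_left₀ hdc]
    rw [hu'', hv'', map_add] at ks'
    have fin : L (((Real.sinh (2 * (c * t)) / 2 / c - κ : ℝ) : ℂ) * u + ((Real.sinh (2 * (d * t)) / 2 / d - κ : ℝ) : ℂ) * v) = 0 := by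
      rw [map_add, Lsmul, Lsmul]
      rw [div_eq_mul_inv _ c, div_eq_mul_inv _ d, ofReal_sub, ofReal_sub, ofReal_mul _ c⁻¹, ofReal_mul _ d⁻¹]
      linear_combination ks'
    have := indep hu hv h1 h2 (Linj _ fin)
    linarith
  have k1 := key (1 / 2) (by norm_num)
  have k2 := key 1 one_pos
  rw [show 2 * (c * (1 / 2)) = c by ring, show 2 * (d * (1 / 2)) = d by ring] at k1
  rw [mul_one, mul_one, Real.sinh_two_mul, Real.sinh_two_mul] at k2
  have hcd : c = d := by
    apply cosh_inj' hc hd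
    have hp : 0 < Real.sinh c / 2 / c := by
      have := Real.sinh_pos_iff.2 hc
      positivity
    apply mul_left_cancel₀ hp.ne'
    have e1 : Real.sinh c / 2 / c * Real.cosh c = (2 * Real.sinh c * Real.cosh c / 2 / c) / 2 := by ring
    rw [e1, k2, k1]; ring
  have n1 : ∀ z : ℂ, normSq z = 1 → ‖z‖ = 1 := by
    intro z hz
    rw [normSq_eq_norm_sq] at hz
    nlinarith [norm_nonneg z]
  rw [hLu, hLv, norm_mul, norm_mul, n1 _ hu', n1 _ hv', hcd]

lemma mid_tanh {u v w m : ℂ} {t s : ℝ} (hu : normSq u = 1) (hv : normSq v = 1) (hw : normSq w = 1)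
    (h2 : normSq (u + v) = 2) (hm : m = pol s w) (h : Mid (pol t u) (pol t v) m) :
    2 * Real.tanh (2 * s) ^ 2 = Real.tanh (2 * t) ^ 2 := by
  obtain ⟨a, a1, a2, a3⟩ := h
  subst hm
  obtain ⟨k, hk, ks, kt⟩ := mid_of (pol_mem t hu) (pol_mem t hv) (pol_mem s hw) a a1 a2 a3
  rw [pol_space' _ hu, pol_space' _ hv, pol_space _ hw, ← mul_add] at ks
  rw [pol_time _ hu, pol_time _ hv, pol_time _ hw] at kt
  have := congrArg normSq ks
  rw [normSq_mul, normSq_mul, hw, h2, normSq_ofReal, normSq_ofReal] at this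
  have p1 := Real.cosh_pos (2 * s)
  have p2 := Real.cosh_pos (2 * t)
  have hk' : k = 2 * Real.cosh (2 * t) / Real.cosh (2 * s) := by
    rw [eq_div_iff p1.ne']; linarith
  rw [Real.tanh_eq_sinh_div_cosh, Real.tanh_eq_sinh_div_cosh]
  rw [hk'] at this
  field_simp at this ⊢
  linarith

lemma lam_one {l : ℝ} (hl : 0 < l) (h : ∀ t > 0, ∃ s > 0, 2 * Real.tanh (2 * s) ^ 2 = Real.tanh (2 * t) ^ 2 ∧
    2 * Real.tanh (2 * (l * s)) ^ 2 = Real.tanh (2 * (l * t)) ^ 2) : l = 1 := by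
  have hs2 : (0 : ℝ) < √2 := by positivity
  have hsq : √2 ^ 2 = (2 : ℝ) := Real.sq_sqrt (by norm_num)
  have h12 : (1 : ℝ) < √2 := by nlinarith
  obtain ⟨σ, hσ, hσt⟩ : ∃ σ : ℝ, 0 < σ ∧ √2 * Real.tanh σ = 1 := by
    have hi : (√2)⁻¹ < 1 := inv_lt_one_of_one_lt₀ h12
    have hi0 : 0 < (√2)⁻¹ := inv_pos.2 hs2
    refine ⟨Real.artanh (√2)⁻¹, Real.artanh_pos ⟨hi0, hi⟩, ?_⟩
    rw [Real.tanh_artanh ⟨by linarith, hi⟩, mul_inv_cancel₀ hs2.ne']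
  have mono : ∀ a b : ℝ, a < b → Real.tanh a < Real.tanh b := by
    intro a b hab
    by_contra hc
    rw [not_lt] at hc
    have := Real.artanh_le_artanh (Real.neg_one_lt_tanh b) (Real.tanh_lt_one a) hc
    rw [Real.artanh_tanh, Real.artanh_tanh] at this
    linarith
  -- for 0 < x < σ, a τ with tanh τ = √2 tanh x
  have ex : ∀ x, 0 < x → x < σ → ∃ τ > 0, Real.tanh τ = √2 * Real.tanh x := by
    intro x h0 hx
    have a1 := tanh_pos' h0
    have a2 := mono _ _ hx
    have b1 : 0 < √2 * Real.tanh x := by positivity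
    have b2 : √2 * Real.tanh x < 1 := by nlinarith
    exact ⟨_, Real.artanh_pos ⟨b1, b2⟩, Real.tanh_artanh ⟨by linarith, b2⟩⟩
  have un : ∀ x y τ : ℝ, 0 < x → 0 < y → Real.tanh τ = √2 * Real.tanh x →
      2 * Real.tanh y ^ 2 = Real.tanh τ ^ 2 → y = x := by
    intro x y τ hx hy h1 h2
    rw [h1, mul_pow, hsq] at h2
    have a1 := tanh_pos' hx
    have a2 := tanh_pos' hy
    apply tanh_inj'
    nlinarith
  have hσ2 : 2 * Real.tanh σ ^ 2 = 1 := by rw [← hsq, ← mul_pow, hσt]; norm_num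
  rcases lt_trichotomy l 1 with h1 | h1 | h1
  · exfalso
    obtain ⟨τ, hτ, e⟩ := ex (l * σ) (by positivity) (by nlinarith)
    obtain ⟨s, hs, e1, e2⟩ := h (τ / (2 * l)) (by positivity)
    rw [show 2 * (l * (τ / (2 * l))) = τ by field_simp] at e2
    have := un _ _ _ (by positivity) (by positivity) e e2
    have hss : 2 * s = σ := by
      apply mul_left_cancel₀ hl.ne'; linarith
    rw [hss, hσ2] at e1
    have := Real.tanh_sq_lt_one (2 * (τ / (2 * l)))
    linarith
  · exact h1
  · exfalso
    obtain ⟨τ, hτ, e⟩ := ex (σ / l) (by positivity) (by rw [div_lt_iff₀ hl]; nlinarith)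
    obtain ⟨s, hs, e1, e2⟩ := h (τ / 2) (by positivity)
    rw [show 2 * (τ / 2) = τ by ring] at e1
    have := un _ _ _ (by positivity) (by positivity) e e1
    have hss : 2 * (l * s) = σ := by
      rw [eq_div_iff hl.ne'] at this; linarith
    rw [hss, hσ2] at e2
    have := Real.tanh_sq_lt_one (2 * (l * (τ / 2)))
    linarith

lemma nsq_one {z : ℂ} : normSq z = 1 ↔ ‖z‖ = 1 := by
  rw [normSq_eq_norm_sq]
  constructor
  · intro h; nlinarith [norm_nonneg z]
  · intro h; rw [h]; norm_num

lemma main_lin {g : ℂ → ℂ} (hmap : ∀ z ∈ unitDisc, g z ∈ unitDisc) (hg : GeoP g) (h0 : g 0 = 0)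
    {L : ℂ →L[ℝ] ℂ} (hL : HasFDerivAt g L 0) :
    (∀ z, ‖L z‖ = ‖z‖) ∧ ∀ z ∈ unitDisc, g z = L z := by
  have Lsmul : ∀ (r : ℝ) (z : ℂ), L ((r : ℂ) * z) = (r : ℂ) * L z := by
    intro r z
    rw [← real_smul, map_smul, real_smul]
  obtain ⟨l, hl⟩ : ∃ l, l = ‖L 1‖ := ⟨_, rfl⟩
  have hunit : ∀ u, normSq u = 1 → ‖L u‖ = l := by
    intro u hu
    rw [hl]
    by_cases h1 : u = 1
    · rw [h1]
    by_cases h2 : u + 1 = 0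
    · rw [show u = -1 by linear_combination h2, map_neg, norm_neg]
    exact speed_eq hmap hg h0 hL hu (by simp) h1 h2
  have hnorm : ∀ z, ‖L z‖ = l * ‖z‖ := by
    intro z
    by_cases hz : z = 0
    · simp [hz]
    have hn : 0 < ‖z‖ := norm_pos_iff.2 hz
    have := hunit (((‖z‖⁻¹ : ℝ) : ℂ) * z) (by
      rw [normSq_eq_norm_sq, norm_mul, Complex.norm_real, norm_inv, norm_norm, inv_mul_cancel₀ hn.ne']; norm_num)
    rw [Lsmul, norm_mul, Complex.norm_real, norm_inv, norm_norm] at this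
    field_simp at this
    linarith
  have hray : ∀ u, normSq u = 1 → ∃ v, normSq v = 1 ∧ L u = (l : ℂ) * v ∧ 0 < l ∧ ∀ t > 0, g (pol t u) = pol (l * t) v := by
    intro u hu
    obtain ⟨c, v, hc, hv, e, h⟩ := ray hmap hg h0 hL hu
    have hcl : c = l := by
      rw [← hunit u hu, e, norm_mul, nsq_one.1 hv, Complex.norm_real, Real.norm_of_nonneg hc.le, mul_one]
    subst hcl
    exact ⟨v, hv, e, hc, h⟩
  have hu1 : normSq (1 : ℂ) = 1 := by simp
  have huI : normSq I = 1 := by simp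
  obtain ⟨v, hv, hLv, hl0, hgv⟩ := hray 1 hu1
  obtain ⟨w, hw, hLw, -, hgw⟩ := hray I huI
  have e2 : normSq (1 + I) = 2 := by simp [normSq_apply]; norm_num
  have e2' : normSq (v + w) = 2 := by
    have : L (1 + I) = (l : ℂ) * (v + w) := by rw [map_add, hLv, hLw]; ring
    have h3 := hnorm (1 + I)
    rw [this, norm_mul, Complex.norm_real, Real.norm_of_nonneg hl0.le] at h3
    have h4 := mul_left_cancel₀ hl0.ne' h3
    rw [normSq_eq_norm_sq, h4, ← normSq_eq_norm_sq, e2]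
  have hl1 : l = 1 := by
    apply lam_one hl0
    intro t ht
    obtain ⟨m, hm, M1, M2⟩ := exists_mid hg (pol_mem t hu1) (pol_mem t huI)
    rw [hgv t ht, hgw t ht] at M2
    have hm0 : m ≠ 0 := by
      rintro rfl
      have := mid_tanh hu1 huI hu1 e2 (pol_zero 1).symm M1
      simp only [mul_zero, Real.tanh_zero] at this
      have := tanh_pos' (show 0 < 2 * t by linarith)
      nlinarith
    obtain ⟨s, y, _, hs, hy, hmy, -⟩ := exists_pol hm hm0
    obtain ⟨y', hy', -, -, hgy⟩ := hray y hy
    refine ⟨s, hs, mid_tanh hu1 huI hy e2 hmy M1, ?_⟩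
    exact mid_tanh hv hw hy' e2' (by rw [hmy]; exact hgy s hs) M2
  rw [hl1] at hnorm hray
  refine ⟨fun z => by rw [hnorm, one_mul], ?_⟩
  intro z hz
  by_cases hz0 : z = 0
  · rw [hz0, h0, map_zero]
  obtain ⟨t, u, _, ht, hu, hzu, -⟩ := exists_pol hz hz0
  obtain ⟨y, hy, e, -, h⟩ := hray u hu
  rw [hzu, h t ht, pol, pol, Lsmul, e, one_mul, ofReal_one, one_mul]

/-- **Lemma 3.1.** A `C²`-smooth geodesic-preserving self-map of the Poincaré disc which
extends `C¹` to an open boundary arc with nowhere vanishing radial derivative is a Möbius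
automorphism or the conjugate of one. -/
theorem geodesic_preserving_disc_map_is_mobius_or_conj
    (f : ℂ → ℂ) (hmap : Set.MapsTo f unitDisc unitDisc)
    (hC2 : ContDiffOn ℝ 2 f unitDisc)
    (hgeo : ∀ γ : ℝ → ℂ, (∀ t, γ t ∈ unitDisc) →
      (∃ c > 0, ∀ s t : ℝ, pdist (γ s) (γ t) = c * |s - t|) →
      (∃ c' > 0, ∀ s t : ℝ, pdist (f (γ s)) (f (γ t)) = c' * |s - t|))
    (U : Set ℂ) (hU : U ⊆ unitCircle) (hUne : U.Nonempty)
    (hUopen : ∃ V : Set ℂ, IsOpen V ∧ U = V ∩ unitCircle)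
    (hC1 : ContDiffOn ℝ 1 f (unitDisc ∪ U))
    (hrad : ∀ p ∈ U, fderivWithin ℝ f (unitDisc ∪ U) p p ≠ 0) :
    IsMobiusOn f ∨ IsMobiusOn (fun z => (starRingEnd ℂ) (f z)) := by
  have hb : f 0 ∈ unitDisc := hmap zero_mem_disc
  obtain ⟨b, hbe⟩ : ∃ b, b = f 0 := ⟨_, rfl⟩
  rw [← hbe] at hb
  have hnb := neg_mem_disc hb
  have hopen : IsOpen unitDisc := isOpen_lt continuous_norm continuous_const
  have hdf : DifferentiableAt ℝ f 0 :=
    (hC2.differentiableOn (by norm_num)).differentiableAt (hopen.mem_nhds zero_mem_disc)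
  have hdg : DifferentiableAt ℝ (fun z => mob (-b) (f z)) 0 := by
    unfold mob
    have hden : DifferentiableAt ℝ (fun z => 1 + (starRingEnd ℂ) (-b) * f z) 0 :=
      (hdf.const_mul _).const_add _
    have hne : 1 + (starRingEnd ℂ) (-b) * f 0 ≠ 0 := by rw [← hbe]; exact mob_den hnb hb
    simp only [div_eq_mul_inv]
    exact (hdf.add_const _).mul (hden.fun_inv hne)
  have hg : GeoP (fun z => mob (-b) (f z)) := by
    intro γ h1 h2
    obtain ⟨c, hc, h⟩ := hgeo γ h1 ⟨1, one_pos, fun s t => by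
      rw [one_mul, pdist_iff (h1 s) (h1 t)]; exact h2 s t⟩
    refine ⟨c, hc, fun s t => ?_⟩
    show sdist (mob (-b) (f (γ s))) (mob (-b) (f (γ t))) = _
    rw [mob_sdist hnb (hmap (h1 s)) (hmap (h1 t)), ← pdist_iff (hmap (h1 s)) (hmap (h1 t)), h,
      abs_mul, abs_of_pos hc]
  obtain ⟨hiso, hfin⟩ := main_lin (g := fun z => mob (-b) (f z))
    (fun z hz => mob_mem hnb (hmap hz)) hg (by simp [mob, hbe]) hdg.hasFDerivAt
  obtain ⟨L, hLe⟩ : ∃ L, L = fderiv ℝ (fun z => mob (-b) (f z)) 0 := ⟨_, rfl⟩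
  rw [← hLe] at hiso hfin
  let Q : ℂ →ₗᵢ[ℝ] ℂ := ⟨L.toLinearMap, hiso⟩
  obtain ⟨a, ha⟩ := linear_isometry_complex (Q.toLinearIsometryEquiv rfl)
  have hQ : ∀ z, L z = Q.toLinearIsometryEquiv rfl z := fun z => rfl
  have hf : ∀ z ∈ unitDisc, f z = (L z + b) / (1 + (starRingEnd ℂ) b * L z) := by
    intro z hz
    rw [← hfin z hz]
    exact (mob_mob hb (hmap hz)).symm
  obtain ⟨θ, hθ⟩ : ∃ θ : ℝ, (a : ℂ) = Complex.exp (θ * Complex.I) :=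
    ⟨Complex.arg a, by
      have := Complex.norm_mul_exp_arg_mul_I (a : ℂ)
      rw [Circle.norm_coe, ofReal_one, one_mul] at this
      exact this.symm⟩
  have haa : (starRingEnd ℂ) (a : ℂ) * a = 1 := by
    rw [← normSq_eq_conj_mul_self, Circle.normSq_coe, ofReal_one]
  have hb1 : ‖b‖ < 1 := hb
  rcases ha with ha | ha
  · left
    refine ⟨θ, -((starRingEnd ℂ) (a : ℂ) * b), ?_, ?_⟩
    · rw [norm_neg, norm_mul, RCLike.norm_conj, Circle.norm_coe, one_mul]; exact hb1
    · intro z hz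
      have e : L z = a * z := by rw [hQ, ha]; rfl
      rw [hf z hz, e, ← hθ, ← mul_div_assoc]
      congr 1
      · linear_combination (-b) * haa
      · simp only [map_neg, map_mul, conj_conj]; ring
  · right
    refine ⟨-θ, -((a : ℂ) * (starRingEnd ℂ) b), ?_, ?_⟩
    · rw [norm_neg, norm_mul, RCLike.norm_conj, Circle.norm_coe, one_mul]; exact hb1
    · intro z hz
      have e : L z = a * (starRingEnd ℂ) z := by rw [hQ, ha]; rfl
      have hθ' : Complex.exp ((-θ : ℝ) * Complex.I) = (starRingEnd ℂ) (a : ℂ) := by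
        rw [hθ, ← Complex.exp_conj, map_mul, conj_I, conj_ofReal]; push_cast; congr 1; ring
      show (starRingEnd ℂ) (f z) = _
      rw [hf z hz, e, hθ', ← mul_div_assoc]
      simp only [map_div₀, map_neg, map_mul, map_add, map_one, conj_conj]
      congr 1
      · linear_combination (-(starRingEnd ℂ) b) * haa
      · ring
end
end

section
/- Let n ≤ m be positive integers and let f : B^n → B^m satisfy d_{B^m}(f(z), f(w)) = d_{B^n}(z, w) for all z, w ∈ B^n (the metric formulation of a totally geodesic isometric embedding with respect to the Bergman metrics). Then there exists a biholomorphic automorphism Ψ of B^m such that either Ψ(f(z)) = (z₁, …, z_n, 0, …, 0) for all z ∈ B^n, or Ψ(f(z)) = (conj(z₁), …, conj(z_n), 0, …, 0) for all z ∈ B^n. -/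
open Complex Metric Set Filter

noncomputable section

/-- The Bergman (hyperbolic) distance on the unit ball `B^n ⊂ ℂ^n`. -/
def ballDist {n : ℕ} (z w : EuclideanSpace ℂ (Fin n)) : ℝ :=
  artanh (Real.sqrt
    (1 - (1 - ‖z‖ ^ 2) * (1 - ‖w‖ ^ 2) /
      ‖(1 - ∑ j, z j * (starRingEnd ℂ) (w j) : ℂ)‖ ^ 2))

/-- `Ψ` is a biholomorphic automorphism of the unit ball `B^m`. -/
def IsBiholoAutBall (m : ℕ) (Ψ : EuclideanSpace ℂ (Fin m) → EuclideanSpace ℂ (Fin m)) : Prop :=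
  Set.MapsTo Ψ (Metric.ball 0 1) (Metric.ball 0 1) ∧
  DifferentiableOn ℂ Ψ (Metric.ball 0 1) ∧
  ∃ Φ : EuclideanSpace ℂ (Fin m) → EuclideanSpace ℂ (Fin m),
    Set.MapsTo Φ (Metric.ball 0 1) (Metric.ball 0 1) ∧
    DifferentiableOn ℂ Φ (Metric.ball 0 1) ∧
    (∀ z ∈ Metric.ball (0 : EuclideanSpace ℂ (Fin m)) 1, Φ (Ψ z) = z) ∧
    (∀ z ∈ Metric.ball (0 : EuclideanSpace ℂ (Fin m)) 1, Ψ (Φ z) = z)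

/-- The standard linear inclusion `ℂ^n → ℂ^m`, `z ↦ (z₁, …, z_n, 0, …, 0)`. -/
def inclBall (n m : ℕ) (z : EuclideanSpace ℂ (Fin n)) : EuclideanSpace ℂ (Fin m) :=
  WithLp.toLp 2 fun j => if h : (j : ℕ) < n then z ⟨j, h⟩ else 0

/-- Componentwise complex conjugation on `ℂ^n`. -/
def conjVec (n : ℕ) (z : EuclideanSpace ℂ (Fin n)) : EuclideanSpace ℂ (Fin n) :=
  WithLp.toLp 2 fun j => (starRingEnd ℂ) (z j)

open scoped ComplexConjugate InnerProductSpace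

section general

variable {E F : Type*} [NormedAddCommGroup E] [InnerProductSpace ℂ E]
  [NormedAddCommGroup F] [InnerProductSpace ℂ F]

/-- The kernel `1 - ⟨z,w⟩`. -/
def kerK (z w : E) : ℂ := 1 - inner ℂ w z

lemma kerK_self (z : E) : kerK z z = ((1 - ‖z‖ ^ 2 : ℝ) : ℂ) := by
  simp [kerK, inner_self_eq_norm_sq_to_K]

lemma norm_kerK_self {z : E} (hz : ‖z‖ < 1) : ‖kerK z z‖ = 1 - ‖z‖ ^ 2 := by
  rw [kerK_self, Complex.norm_real, Real.norm_eq_abs, abs_of_nonneg]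
  nlinarith [norm_nonneg z]

lemma norm_kerK_ge {z w : E} : 1 - ‖z‖ * ‖w‖ ≤ ‖kerK z w‖ := by
  have h1 : ‖inner ℂ w z‖ ≤ ‖w‖ * ‖z‖ := norm_inner_le_norm w z
  have h2 : ‖(1 : ℂ)‖ - ‖inner ℂ w z‖ ≤ ‖kerK z w‖ := norm_sub_norm_le _ _
  rw [norm_one] at h2
  linarith [mul_comm ‖w‖ ‖z‖]

lemma kerK_pos {z w : E} (hz : ‖z‖ < 1) (hw : ‖w‖ < 1) : 0 < ‖kerK z w‖ := by
  have := norm_kerK_ge (z := z) (w := w)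
  nlinarith [norm_nonneg z, norm_nonneg w]

lemma kerK_ne {z w : E} (hz : ‖z‖ < 1) (hw : ‖w‖ < 1) : kerK z w ≠ 0 :=
  norm_pos_iff.1 (kerK_pos hz hw)

/-- The invariant cross quantity. -/
def sig (z w : E) : ℝ := (1 - ‖z‖ ^ 2) * (1 - ‖w‖ ^ 2) / ‖kerK z w‖ ^ 2

lemma sig_pos {z w : E} (hz : ‖z‖ < 1) (hw : ‖w‖ < 1) : 0 < sig z w := by
  have := kerK_pos hz hw
  have h1 : 0 < 1 - ‖z‖ ^ 2 := by nlinarith [norm_nonneg z]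
  have h2 : 0 < 1 - ‖w‖ ^ 2 := by nlinarith [norm_nonneg w]
  unfold sig
  positivity

lemma sig_le {z w : E} (hz : ‖z‖ < 1) (hw : ‖w‖ < 1) : sig z w ≤ 1 := by
  have h0 := kerK_pos hz hw
  have h := norm_kerK_ge (z := z) (w := w)
  have h3 : 0 ≤ 1 - ‖z‖ * ‖w‖ := by nlinarith [norm_nonneg z, norm_nonneg w]
  unfold sig
  rw [div_le_one (by positivity)]
  calc _ ≤ (1 - ‖z‖ * ‖w‖) ^ 2 := by nlinarith [sq_nonneg (‖z‖ - ‖w‖)]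
    _ ≤ _ := by gcongr

lemma artanh_inj {x y : ℝ} (hx : 0 ≤ x) (hx1 : x < 1) (hy : 0 ≤ y) (hy1 : y < 1)
    (h : artanh x = artanh y) : x = y := by
  unfold artanh at h
  have h1 : Real.log ((1 + x) / (1 - x)) = Real.log ((1 + y) / (1 - y)) := by linarith
  have hx2 : 0 < 1 - x := by linarith
  have hy2 : 0 < 1 - y := by linarith
  have h2 := Real.log_injOn_pos (Set.mem_Ioi.2 (by positivity)) (Set.mem_Ioi.2 (by positivity)) h1
  rw [div_eq_div_iff hx2.ne' hy2.ne'] at h2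
  linarith

/-- Square root of `1 - |a|²`. -/
def sA (a : E) : ℝ := Real.sqrt (1 - ‖a‖ ^ 2)

lemma sA_pos {a : E} (ha : ‖a‖ < 1) : 0 < sA a :=
  Real.sqrt_pos.2 (by nlinarith [norm_nonneg a])

lemma sA_sq {a : E} (ha : ‖a‖ < 1) : sA a ^ 2 = 1 - ‖a‖ ^ 2 :=
  Real.sq_sqrt (by nlinarith [norm_nonneg a])

/-- The involutive automorphism exchanging `0` and `a`. -/
def phi (a z : E) : E :=
  (1 - inner ℂ a z)⁻¹ • (a - (sA a : ℂ) • z - (inner ℂ a z / (1 + (sA a : ℂ))) • a)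

lemma sA_ne {a : E} (ha : ‖a‖ < 1) : (1 + (sA a : ℂ)) ≠ 0 := by
  have := sA_pos ha
  exact_mod_cast (by linarith : (1 + sA a) ≠ 0)

lemma inner_aa {a : E} (ha : ‖a‖ < 1) : inner ℂ a a = 1 - (sA a : ℂ) ^ 2 := by
  rw [inner_self_eq_norm_sq_to_K]
  have := sA_sq ha
  have h : ‖a‖ ^ 2 = 1 - sA a ^ 2 := by linarith
  have h' : ((‖a‖ ^ 2 : ℝ) : ℂ) = ((1 - sA a ^ 2 : ℝ) : ℂ) := by rw [h]
  push_cast at h'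
  exact h'

lemma kerK_phi {a z w : E} (ha : ‖a‖ < 1) (hz : ‖z‖ < 1) (hw : ‖w‖ < 1) :
    kerK (phi a z) (phi a w) = (sA a : ℂ) ^ 2 * kerK z w / (kerK z a * kerK a w) := by
  have h1 := kerK_ne hz ha
  have h2 := kerK_ne ha hw
  have h3 := sA_ne ha
  have hc : conj (inner ℂ a w) = inner ℂ w a := inner_conj_symm _ _
  unfold kerK phi at *
  simp only [inner_smul_left, inner_smul_right, inner_sub_left, inner_sub_right, inner_aa ha,
    map_sub, map_inv₀, map_one, hc, map_div₀, map_add, Complex.conj_ofReal]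
  field_simp
  ring

lemma phi_mem {a z : E} (ha : ‖a‖ < 1) (hz : ‖z‖ < 1) : ‖phi a z‖ < 1 := by
  have h := kerK_phi ha hz hz
  have h1 := kerK_pos hz ha
  have h2 : kerK a z = conj (kerK z a) := by simp [kerK]
  have h4 : kerK z a * kerK a z = ((‖kerK z a‖ ^ 2 : ℝ) : ℂ) := by
    rw [h2, Complex.mul_conj, Complex.normSq_eq_norm_sq]
  rw [h4, kerK_self, kerK_self] at h
  have h5 : 1 - ‖phi a z‖ ^ 2 = sA a ^ 2 * (1 - ‖z‖ ^ 2) / ‖kerK z a‖ ^ 2 := by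
    exact_mod_cast h
  have h6 : 0 < 1 - ‖z‖ ^ 2 := by nlinarith [norm_nonneg z]
  have h7 := sA_pos ha
  have h8 : 0 < 1 - ‖phi a z‖ ^ 2 := by rw [h5]; positivity
  nlinarith [norm_nonneg (phi a z)]

lemma phi_self {a : E} (ha : ‖a‖ < 1) : phi a a = 0 := by
  unfold phi
  rw [inner_aa ha]
  have h3 := sA_ne ha
  have : a - (sA a : ℂ) • a - ((1 - (sA a : ℂ) ^ 2) / (1 + (sA a : ℂ))) • a
    = (1 - (sA a : ℂ) - ((1 - (sA a : ℂ) ^ 2) / (1 + (sA a : ℂ)))) • a := by module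
  rw [this]
  have h : (1 - (sA a : ℂ) - ((1 - (sA a : ℂ) ^ 2) / (1 + (sA a : ℂ)))) = 0 := by
    field_simp; ring
  rw [h]; simp

lemma phi_invol {a z : E} (ha : ‖a‖ < 1) (hz : ‖z‖ < 1) : phi a (phi a z) = z := by
  have h1 := kerK_ne hz ha
  have h3 := sA_ne ha
  have hs : (sA a : ℂ) ≠ 0 := by exact_mod_cast (sA_pos ha).ne'
  unfold kerK at h1
  have h4 : inner ℂ a (phi a z) = (1 - (sA a : ℂ) ^ 2 - inner ℂ a z) / (1 - inner ℂ a z) := by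
    unfold phi
    simp only [inner_smul_right, inner_sub_right, inner_aa ha]
    field_simp
    ring
  have h5 : 1 - inner ℂ a (phi a z) = (sA a : ℂ) ^ 2 / (1 - inner ℂ a z) := by
    rw [h4]; field_simp; ring
  rw [phi, h5, h4]
  unfold phi
  generalize inner ℂ a z = α at *
  generalize (sA a : ℂ) = s at *
  rw [inv_smul_eq_iff₀ (by positivity)]
  match_scalars
  · field_simp
    ring
  · field_simp

lemma phi_diff {a : E} (ha : ‖a‖ < 1) : DifferentiableOn ℂ (phi a) (Metric.ball 0 1) := by
  have hi : Differentiable ℂ (fun z : E => inner ℂ a z) := (innerSL ℂ a).differentiable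
  unfold phi
  refine DifferentiableOn.smul (DifferentiableOn.inv ?_ ?_) ?_
  · exact ((differentiable_const _).sub hi).differentiableOn
  · intro z hz
    exact kerK_ne (mem_ball_zero_iff.1 hz) ha
  · apply Differentiable.differentiableOn
    exact ((differentiable_const _).sub (differentiable_id.const_smul _)).sub
      (Differentiable.smul_const (by simpa only [div_eq_mul_inv] using hi.mul_const _) _)

lemma sig_eq {z w : E} (hz : ‖z‖ < 1) (hw : ‖w‖ < 1) :
    sig z w = ‖kerK z z‖ * ‖kerK w w‖ / ‖kerK z w‖ ^ 2 := by
  rw [norm_kerK_self hz, norm_kerK_self hw, sig]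

lemma norm_kerK_comm (z w : E) : ‖kerK z w‖ = ‖kerK w z‖ := by
  have h2 : kerK z w = conj (kerK w z) := by simp [kerK]
  rw [h2, RCLike.norm_conj]

lemma sig_phi {a z w : E} (ha : ‖a‖ < 1) (hz : ‖z‖ < 1) (hw : ‖w‖ < 1) :
    sig (phi a z) (phi a w) = sig z w := by
  rw [sig_eq hz hw, sig_eq (phi_mem ha hz) (phi_mem ha hw), kerK_phi ha hz hz, kerK_phi ha hz hw,
    kerK_phi ha hw hw]
  have h1 := kerK_pos hz ha
  have h2 := kerK_pos hw ha
  have h3 := kerK_pos hz hw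
  have h4 := sA_pos ha
  simp only [norm_div, norm_mul, norm_pow, norm_kerK_comm a, Complex.norm_real, Real.norm_eq_abs,
    abs_of_pos h4]
  field_simp

section core

variable {g : E → F}

lemma core_smul (hn : ∀ z, ‖z‖ < 1 → ‖g z‖ = ‖z‖)
    (hK : ∀ z w, ‖z‖ < 1 → ‖w‖ < 1 → ‖kerK (g z) (g w)‖ = ‖kerK z w‖)
    {z : E} (hz : ‖z‖ < 1) {r : ℝ} (hr : 0 ≤ r) (hr1 : r ≤ 1) :
    g ((r : ℂ) • z) = (r : ℂ) • g z := by
  have hnw : ‖(r : ℂ) • z‖ = r * ‖z‖ := by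
    rw [norm_smul, Complex.norm_real, Real.norm_eq_abs, abs_of_nonneg hr]
  have hw : ‖(r : ℂ) • z‖ < 1 := by rw [hnw]; nlinarith [norm_nonneg z]
  have h := hK _ _ hz hw
  have h1 : kerK z ((r : ℂ) • z) = ((1 - r * ‖z‖ ^ 2 : ℝ) : ℂ) := by
    simp [kerK, inner_smul_left, inner_self_eq_norm_sq_to_K]
  rw [h1, Complex.norm_real, Real.norm_eq_abs, abs_of_nonneg (by nlinarith [norm_nonneg z])] at h
  have h2 : (kerK (g z) (g ((r : ℂ) • z))).re ≤ _ := Complex.re_le_norm _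
  rw [h] at h2
  simp only [kerK, Complex.sub_re, Complex.one_re] at h2
  have h3 := @norm_sub_sq ℂ F _ _ _ (g ((r : ℂ) • z)) ((r : ℂ) • g z)
  rw [inner_smul_right, norm_smul, hn _ hw, hn _ hz, hnw, Complex.norm_real, Real.norm_eq_abs,
    abs_of_nonneg hr] at h3
  simp only [RCLike.re_to_complex, Complex.re_ofReal_mul] at h3
  have h4 : ‖g ((r : ℂ) • z) - (r : ℂ) • g z‖ ^ 2 ≤ 0 := by
    rw [h3]
    nlinarith [mul_le_mul_of_nonneg_left h2 hr]
  have h5 : ‖g ((r : ℂ) • z) - (r : ℂ) • g z‖ = 0 := by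
    nlinarith [norm_nonneg (g ((r : ℂ) • z) - (r : ℂ) • g z)]
  exact sub_eq_zero.1 (norm_eq_zero.1 h5)

lemma norm_one_sub_sq (p : ℂ) (t : ℝ) :
    ‖1 - (t : ℂ) * p‖ ^ 2 = 1 - 2 * t * p.re + t ^ 2 * ‖p‖ ^ 2 := by
  rw [← Complex.normSq_eq_norm_sq, ← Complex.normSq_eq_norm_sq, Complex.normSq_apply,
    Complex.normSq_apply]
  simp
  ring

lemma core_inner (hn : ∀ z, ‖z‖ < 1 → ‖g z‖ = ‖z‖)
    (hK : ∀ z w, ‖z‖ < 1 → ‖w‖ < 1 → ‖kerK (g z) (g w)‖ = ‖kerK z w‖)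
    {z w : E} (hz : ‖z‖ < 1) (hw : ‖w‖ < 1) :
    (inner ℂ (g w) (g z)).re = (inner ℂ w z).re ∧ ‖inner ℂ (g w) (g z)‖ = ‖inner ℂ w z‖ := by
  have key : ∀ t : ℝ, 0 ≤ t → t ≤ 1 →
      ‖1 - (t : ℂ) * inner ℂ (g w) (g z)‖ ^ 2 = ‖1 - (t : ℂ) * inner ℂ w z‖ ^ 2 := by
    intro t ht ht1
    have hz' : ‖(t : ℂ) • z‖ < 1 := by
      rw [norm_smul, Complex.norm_real, Real.norm_eq_abs, abs_of_nonneg ht]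
      nlinarith [norm_nonneg z]
    have := hK _ _ hz' hw
    rw [core_smul hn hK hz ht ht1] at this
    simp only [kerK, inner_smul_right] at this
    rw [this]
  have k1 := key 1 zero_le_one le_rfl
  have k2 := key (1 / 2) (by norm_num) (by norm_num)
  rw [norm_one_sub_sq, norm_one_sub_sq] at k1 k2
  constructor
  · linarith
  · rw [← sq_eq_sq₀ (norm_nonneg _) (norm_nonneg _)]
    linarith

/-- Extension of `g` to the whole space. -/
def extG (g : E → F) (z : E) : F :=
  ((1 + ‖z‖ : ℝ) : ℂ) • g ((((1 + ‖z‖)⁻¹ : ℝ) : ℂ) • z)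

lemma scale_mem (z : E) : ‖(((1 + ‖z‖)⁻¹ : ℝ) : ℂ) • z‖ < 1 := by
  have : 0 < 1 + ‖z‖ := by positivity
  rw [norm_smul, Complex.norm_real, Real.norm_eq_abs, abs_of_pos (by positivity), inv_mul_lt_iff₀ this]
  linarith

lemma extG_eq (hn : ∀ z, ‖z‖ < 1 → ‖g z‖ = ‖z‖)
    (hK : ∀ z w, ‖z‖ < 1 → ‖w‖ < 1 → ‖kerK (g z) (g w)‖ = ‖kerK z w‖)
    {z : E} (hz : ‖z‖ < 1) : extG g z = g z := by
  have h : 0 < 1 + ‖z‖ := by positivity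
  rw [extG, core_smul hn hK hz (by positivity) (inv_le_one_of_one_le₀ (by linarith [norm_nonneg z])),
    smul_smul, ← Complex.ofReal_mul, mul_inv_cancel₀ h.ne']
  simp

lemma extG_inner (hn : ∀ z, ‖z‖ < 1 → ‖g z‖ = ‖z‖)
    (hK : ∀ z w, ‖z‖ < 1 → ‖w‖ < 1 → ‖kerK (g z) (g w)‖ = ‖kerK z w‖) (z w : E) :
    (inner ℂ (extG g w) (extG g z)).re = (inner ℂ w z).re ∧
      ‖inner ℂ (extG g w) (extG g z)‖ = ‖inner ℂ w z‖ := by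
  obtain ⟨h1, h2⟩ := core_inner hn hK (scale_mem z) (scale_mem w)
  have hz : 0 < 1 + ‖z‖ := by positivity
  have hw : 0 < 1 + ‖w‖ := by positivity
  simp only [extG, inner_smul_left, inner_smul_right, Complex.conj_ofReal] at h1 h2 ⊢
  generalize inner ℂ (g _) (g _) = p at *
  generalize inner ℂ w z = q at *
  simp only [Complex.re_ofReal_mul, norm_mul, Complex.norm_real, Real.norm_eq_abs, abs_of_pos hz,
    abs_of_pos hw, abs_of_pos (inv_pos.2 hz), abs_of_pos (inv_pos.2 hw)] at h1 h2 ⊢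
  rw [h1, h2]
  constructor <;> field_simp

end core

/-- A map preserving real parts and moduli of inner products is linear or antilinear. -/
lemma lin_of_inner {G : E → F}
    (h : ∀ z w, (inner ℂ (G w) (G z)).re = (inner ℂ w z).re ∧
      ‖inner ℂ (G w) (G z)‖ = ‖inner ℂ w z‖) :
    (∀ z w, G (z + w) = G z + G w) ∧
      ((∀ (c : ℂ) z, G (c • z) = c • G z) ∨ (∀ (c : ℂ) z, G (c • z) = conj c • G z)) := by
  have hr := fun z w => (h z w).1
  have hadd : ∀ z w, G (z + w) = G z + G w := by
    intro z w
    have : (inner ℂ (G (z + w) - (G z + G w)) (G (z + w) - (G z + G w))).re = 0 := by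
      simp only [inner_sub_left, inner_sub_right, inner_add_left, inner_add_right, Complex.add_re,
        Complex.sub_re, hr]
      ring
    have h2 := @inner_self_eq_zero ℂ F _ _ _ (G (z + w) - (G z + G w))
    refine sub_eq_zero.1 (h2.1 ?_)
    apply Complex.ext this
    exact inner_self_im (𝕜 := ℂ) _
  have hsm : ∀ (r : ℝ) z, G ((r : ℂ) • z) = (r : ℂ) • G z := by
    intro r z
    have : (inner ℂ (G ((r : ℂ) • z) - (r : ℂ) • G z) (G ((r : ℂ) • z) - (r : ℂ) • G z)).re = 0 := by
      have e1 := hr z z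
      have e2 := hr z ((r : ℂ) • z)
      have e3 := hr ((r : ℂ) • z) z
      have e4 := hr ((r : ℂ) • z) ((r : ℂ) • z)
      rw [inner_sub_left, inner_sub_right, inner_sub_right]
      generalize G ((r : ℂ) • z) = y at *
      simp only [inner_smul_left, inner_smul_right, Complex.conj_ofReal, Complex.re_ofReal_mul,
        Complex.sub_re] at *
      rw [e1, e2, e3, e4]
      ring
    have h2 := @inner_self_eq_zero ℂ F _ _ _ (G ((r : ℂ) • z) - (r : ℂ) • G z)
    refine sub_eq_zero.1 (h2.1 ?_)
    apply Complex.ext this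
    exact inner_self_im (𝕜 := ℂ) _
  have hnorm : ∀ z, ‖G z‖ = ‖z‖ := by
    intro z
    have h1 := (h z z).2
    rw [inner_self_eq_norm_sq_to_K, inner_self_eq_norm_sq_to_K] at h1
    simpa using h1
  have hI : ∀ z, G (I • z) = I • G z ∨ G (I • z) = -(I • G z) := by
    intro z
    obtain ⟨h1, h2⟩ := h (I • z) z
    have e : inner ℂ z (I • z) = I * ((‖z‖ ^ 2 : ℝ) : ℂ) := by
      rw [inner_smul_right, inner_self_eq_norm_sq_to_K]; simp
    rw [e] at h1 h2
    have h1' : (inner ℂ (G z) (G (I • z))).re = 0 := by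
      rw [h1, mul_comm, Complex.re_ofReal_mul]; simp
    have h2' : ‖inner ℂ (G z) (G (I • z))‖ = ‖z‖ ^ 2 := by
      rw [h2]; simp
    have hIz : ‖I • z‖ = ‖z‖ := by simp [norm_smul]
    have hIG : ‖I • G z‖ = ‖z‖ := by simp [norm_smul, hnorm]
    have him : |(inner ℂ (G z) (G (I • z))).im| = ‖z‖ ^ 2 := by
      rw [← h2']
      exact Complex.abs_im_eq_norm.2 h1'
    have hre : (inner ℂ (I • G z) (G (I • z))).re = (inner ℂ (G z) (G (I • z))).im := by
      rw [inner_smul_left]; simp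
    have hsub := @norm_sub_sq ℂ F _ _ _ (I • G z) (G (I • z))
    have hadd' := @norm_add_sq ℂ F _ _ _ (I • G z) (G (I • z))
    simp only [RCLike.re_to_complex, hre, hIG, hnorm, hIz] at hsub hadd'
    rcases (abs_eq (by positivity)).1 him with h3 | h3
    · left
      rw [h3] at hsub
      have : ‖I • G z - G (I • z)‖ = 0 := by
        rw [← sq_eq_zero_iff, hsub]; ring
      exact (sub_eq_zero.1 (norm_eq_zero.1 this)).symm
    · right
      rw [h3] at hadd'
      have : ‖I • G z + G (I • z)‖ = 0 := by
        rw [← sq_eq_zero_iff, hadd']; ring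
      exact (neg_eq_of_add_eq_zero_right (norm_eq_zero.1 this)).symm
  have hdec : ∀ (c : ℂ) z, G (c • z) = (c.re : ℂ) • G z + (c.im : ℂ) • G (I • z) := by
    intro c z
    rw [← hsm, ← hsm, ← hadd, smul_smul, ← add_smul, Complex.re_add_im]
  refine ⟨hadd, ?_⟩
  by_cases hall : ∀ z, G (I • z) = I • G z
  · left
    intro c z
    rw [hdec, hall, smul_smul, ← add_smul, Complex.re_add_im]
  · right
    push Not at hall
    obtain ⟨z, hz⟩ := hall
    have hall2 : ∀ w, G (I • w) = -(I • G w) := by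
      intro w
      by_contra hw
      have hz' := (hI z).resolve_left hz
      have hw' := (hI w).resolve_right hw
      have hs := hI (z + w)
      rw [smul_add, hadd, hadd, hz', hw', smul_add] at hs
      rcases hs with hs | hs
      · apply hz
        rw [hz']
        exact add_right_cancel hs
      · apply hw
        rw [hw']
        rw [neg_add] at hs
        exact add_left_cancel hs
    intro c z
    rw [hdec, hall2, ← neg_smul, smul_smul, ← add_smul]
    congr 1
    apply Complex.ext <;> simp

end general

lemma ballDist_eq {n : ℕ} (z w : EuclideanSpace ℂ (Fin n)) :
    ballDist z w = artanh (Real.sqrt (1 - sig z w)) := by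
  unfold ballDist sig kerK
  rw [PiLp.inner_apply]
  simp [mul_comm]

lemma sig_of_dist {n m : ℕ} {z w : EuclideanSpace ℂ (Fin n)} {z' w' : EuclideanSpace ℂ (Fin m)}
    (hz : ‖z‖ < 1) (hw : ‖w‖ < 1) (hz' : ‖z'‖ < 1) (hw' : ‖w'‖ < 1)
    (h : ballDist z' w' = ballDist z w) : sig z' w' = sig z w := by
  rw [ballDist_eq, ballDist_eq] at h
  have a1 := sig_pos hz hw
  have a2 := sig_le hz hw
  have b1 := sig_pos hz' hw'
  have b2 := sig_le hz' hw'
  have h1 := artanh_inj (Real.sqrt_nonneg _)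
    (by rw [Real.sqrt_lt' one_pos]; linarith) (Real.sqrt_nonneg _)
    (by rw [Real.sqrt_lt' one_pos]; linarith) h
  have h2 := (Real.sqrt_inj (by linarith) (by linarith)).1 h1
  linarith

/-- Straightening by a unitary map. -/
lemma straighten {n m : ℕ} (hnm : n ≤ m) (v : Fin n → EuclideanSpace ℂ (Fin m))
    (hv : Orthonormal ℂ v) :
    ∃ U : EuclideanSpace ℂ (Fin m) ≃ₗᵢ[ℂ] EuclideanSpace ℂ (Fin m),
      ∀ z : EuclideanSpace ℂ (Fin n), U (∑ j, z j • v j) = inclBall n m z := by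
  let V : Fin m → EuclideanSpace ℂ (Fin m) := fun j => if h : (j : ℕ) < n then v ⟨j, h⟩ else 0
  let s : Set (Fin m) := {j | (j : ℕ) < n}
  have hV : Orthonormal ℂ (s.domRestrict V) := by
    have : s.domRestrict V = v ∘ (fun j : s => (⟨j.1.1, j.2⟩ : Fin n)) := by
      funext j
      have := j.2
      simp only [s, Set.mem_ofPred_eq] at this
      simp [V, Set.domRestrict, this]
    rw [this]
    apply hv.comp
    intro a b hab
    simp only [Fin.mk.injEq] at hab
    exact Subtype.ext (Fin.ext hab)
  obtain ⟨b, hb⟩ := hV.exists_orthonormalBasis_extension_of_card_eq (by simp)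
  refine ⟨b.repr, fun z => ?_⟩
  have hvb : ∀ j : Fin n, v j = b (Fin.castLE hnm j) := by
    intro j
    rw [hb _ (by simp [s])]
    simp [V]
  ext i
  simp only [map_sum, map_smul, hvb, OrthonormalBasis.repr_self, inclBall]
  simp only [WithLp.ofLp_sum, Finset.sum_apply, PiLp.smul_apply, EuclideanSpace.single_apply,
    smul_eq_mul, mul_ite, mul_one, mul_zero]
  by_cases hi : (i : ℕ) < n
  · rw [Finset.sum_eq_single ⟨i, hi⟩]
    · simp [hi]
    · intro j _ hj
      rw [if_neg]
      rintro rfl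
      exact hj rfl
    · simp
  · simp only [hi, dif_neg, not_false_eq_true]
    apply Finset.sum_eq_zero
    intro j _
    rw [if_neg]
    rintro rfl
    exact hi j.2

/-- **Corollary 3.3.** Every totally geodesic isometric embedding `B^n → B^m` is, up to an
automorphism of `B^m`, the standard embedding or its conjugate. -/
theorem totally_geodesic_ball_in_ball
    (n m : ℕ) (hn : 0 < n) (hnm : n ≤ m)
    (f : EuclideanSpace ℂ (Fin n) → EuclideanSpace ℂ (Fin m))
    (hmap : Set.MapsTo f (Metric.ball 0 1) (Metric.ball 0 1))
    (hiso : ∀ z ∈ Metric.ball (0 : EuclideanSpace ℂ (Fin n)) 1,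
      ∀ w ∈ Metric.ball (0 : EuclideanSpace ℂ (Fin n)) 1,
        ballDist (f z) (f w) = ballDist z w) :
    ∃ Ψ : EuclideanSpace ℂ (Fin m) → EuclideanSpace ℂ (Fin m), IsBiholoAutBall m Ψ ∧
      ((∀ z ∈ Metric.ball (0 : EuclideanSpace ℂ (Fin n)) 1, Ψ (f z) = inclBall n m z) ∨
       (∀ z ∈ Metric.ball (0 : EuclideanSpace ℂ (Fin n)) 1,
          Ψ (f z) = inclBall n m (conjVec n z))) := by
  have hb : ∀ {k : ℕ} {z : EuclideanSpace ℂ (Fin k)}, z ∈ Metric.ball 0 1 ↔ ‖z‖ < 1 :=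
    mem_ball_zero_iff
  have ha : ‖f 0‖ < 1 := hb.1 (hmap (by simp))
  set a := f 0 with ha_def
  let g : EuclideanSpace ℂ (Fin n) → EuclideanSpace ℂ (Fin m) := fun z => phi a (f z)
  have hf : ∀ z, ‖z‖ < 1 → ‖f z‖ < 1 := fun z hz => hb.1 (hmap (hb.2 hz))
  have hg : ∀ z, ‖z‖ < 1 → ‖g z‖ < 1 := fun z hz => phi_mem ha (hf z hz)
  have hsig : ∀ z w, ‖z‖ < 1 → ‖w‖ < 1 → sig (g z) (g w) = sig z w := by
    intro z w hz hw
    rw [sig_phi ha (hf z hz) (hf w hw)]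
    exact sig_of_dist hz hw (hf z hz) (hf w hw) (hiso z (hb.2 hz) w (hb.2 hw))
  have hg0 : g 0 = 0 := phi_self ha
  have hnorm : ∀ z, ‖z‖ < 1 → ‖g z‖ = ‖z‖ := by
    intro z hz
    have := hsig z 0 hz (by simp)
    rw [hg0] at this
    simp only [sig, kerK, inner_zero_left, norm_zero] at this
    norm_num at this
    exact this
  have hK : ∀ z w, ‖z‖ < 1 → ‖w‖ < 1 → ‖kerK (g z) (g w)‖ = ‖kerK z w‖ := by
    intro z w hz hw
    have := hsig z w hz hw
    have k1 := kerK_pos hz hw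
    have k2 := kerK_pos (hg z hz) (hg w hw)
    have h1 : 0 < 1 - ‖z‖ ^ 2 := by nlinarith [norm_nonneg z]
    have h2 : 0 < 1 - ‖w‖ ^ 2 := by nlinarith [norm_nonneg w]
    rw [sig, sig, hnorm z hz, hnorm w hw, div_eq_div_iff (by positivity) (by positivity)] at this
    have h3 := mul_left_cancel₀ (by positivity) this
    exact ((sq_eq_sq₀ k1.le k2.le).1 h3).symm
  have hGi := extG_inner hnorm hK
  obtain ⟨hadd, hlin⟩ := lin_of_inner hGi
  set G := extG g with hG
  have hGg : ∀ z, ‖z‖ < 1 → g z = G z := fun z hz => (extG_eq hnorm hK hz).symm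
  let e : Fin n → EuclideanSpace ℂ (Fin n) := fun j => EuclideanSpace.single j 1
  have hsingle : Orthonormal ℂ e := EuclideanSpace.orthonormal_single
  have hv : Orthonormal ℂ (fun j => G (e j)) := by
    constructor
    · intro j
      have h1 := (hGi (e j) (e j)).2
      rw [inner_self_eq_norm_sq_to_K, inner_self_eq_norm_sq_to_K, hsingle.1 j] at h1
      simp only [norm_pow, RCLike.norm_ofReal, abs_norm, abs_one] at h1
      exact (sq_eq_sq₀ (norm_nonneg _) zero_le_one).1 h1
    · intro i j hij
      have h1 := (hGi (e j) (e i)).2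
      rw [hsingle.2 hij, norm_zero] at h1
      exact norm_eq_zero.1 h1
  have hdecomp : ∀ z : EuclideanSpace ℂ (Fin n), z = ∑ j, z j • e j := by
    intro z
    ext i
    simp [e, Finset.sum_apply, Pi.single_apply]
  have hGsum : ∀ z : EuclideanSpace ℂ (Fin n), G z = ∑ j, G (z j • e j) := by
    intro z
    conv_lhs => rw [hdecomp z]
    exact map_sum (AddMonoidHom.mk' G hadd) _ _
  obtain ⟨U, hU⟩ := straighten hnm _ hv
  refine ⟨fun z => U (phi a z), ⟨?_, ?_, fun z => phi a (U.symm z), ?_, ?_, ?_, ?_⟩, ?_⟩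
  · intro z hz
    rw [hb, LinearIsometryEquiv.norm_map]
    exact phi_mem ha (hb.1 hz)
  · exact U.toContinuousLinearEquiv.differentiable.comp_differentiableOn (phi_diff ha)
  · intro z hz
    rw [hb]
    exact phi_mem ha (by rw [LinearIsometryEquiv.norm_map]; exact hb.1 hz)
  · refine (phi_diff ha).comp U.symm.toContinuousLinearEquiv.differentiable.differentiableOn ?_
    intro z hz
    rw [hb]
    exact (LinearIsometryEquiv.norm_map U.symm z).trans_lt (hb.1 hz)
  · intro z hz
    simp only [LinearIsometryEquiv.symm_apply_apply]
    exact phi_invol ha (hb.1 hz)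
  · intro z hz
    simp only
    rw [phi_invol ha (by rw [LinearIsometryEquiv.norm_map]; exact hb.1 hz)]
    simp
  · rcases hlin with hl | hl
    · left
      intro z hz
      have h1 : phi a (f z) = G z := hGg z (hb.1 hz)
      simp only [h1]
      rw [hGsum z, ← hU z]
      simp only [hl]
    · right
      intro z hz
      have h1 : phi a (f z) = G z := hGg z (hb.1 hz)
      simp only [h1]
      rw [hGsum z, ← hU (conjVec n z)]
      simp only [hl, conjVec]
end
end

section
/- Let p be a positive integer, λ > 0 a real number, and let f = (f₁, …, f_p) : D → D^p be a C²-smooth map with d_p(f(z), f(w)) = √λ · ρ(z, w) for all z, w ∈ D. Suppose f extends C¹-smoothly to D ∪ U for some nonempty open arc U ⊂ ∂D, and the radial derivative of f is nonzero at every point of U. Then λ is a positive integer with λ ≤ p, and there exists a subset S ⊆ {1, …, p} with exactly λ elements such that for each j ∈ S the component f_j is either a Möbius automorphism of D or the complex conjugate of a Möbius automorphism of D, and for each j ∉ S the component f_j is constant. -/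
open Complex Metric Set Filter

noncomputable section

/-- The distance of the product Poincaré metric on the polydisc `D^p`. -/
def polyDist (p : ℕ) (z w : Fin p → ℂ) : ℝ :=
  Real.sqrt (∑ j, (pdist (z j) (w j)) ^ 2)

namespace TG

def nT (z : ℂ) : ℝ := (1 + (z.re^2+z.im^2)) / (1 - (z.re^2+z.im^2))
def nA (z : ℂ) : ℝ := 2*z.re / (1 - (z.re^2+z.im^2))
def nB (z : ℂ) : ℝ := 2*z.im / (1 - (z.re^2+z.im^2))
def cc (z w : ℂ) : ℝ := nT z * nT w - nA z * nA w - nB z * nB w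

lemma nsq (z : ℂ) : ‖z‖^2 = z.re^2+z.im^2 := by
  rw [Complex.sq_norm, Complex.normSq_apply]; ring

lemma dpos {z : ℂ} (hz : ‖z‖ < 1) : 0 < 1 - (z.re^2+z.im^2) := by
  rw [← nsq]; nlinarith [norm_nonneg z]

lemma disc_of {z : ℂ} (h : z.re^2+z.im^2 < 1) : ‖z‖ < 1 := by
  rw [← nsq] at h; nlinarith [norm_nonneg z]

lemma nT_pos {z : ℂ} (hz : ‖z‖ < 1) : 0 < nT z := by
  have := dpos hz
  unfold nT; positivity

lemma n_rel {z : ℂ} (hz : ‖z‖ < 1) : nT z^2 - nA z^2 - nB z^2 = 1 := by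
  have := dpos hz
  unfold nT nA nB; field_simp; ring

lemma cc_eq {z w : ℂ} (hz : ‖z‖ < 1) (hw : ‖w‖ < 1) :
    cc z w = 1 + 2*((z.re-w.re)^2+(z.im-w.im)^2)/
      ((1 - (z.re^2+z.im^2)) * (1 - (w.re^2+w.im^2))) := by
  have := dpos hz
  have := dpos hw
  unfold cc nT nA nB; field_simp; ring

lemma one_le_cc {z w : ℂ} (hz : ‖z‖ < 1) (hw : ‖w‖ < 1) : 1 ≤ cc z w := by
  have := dpos hz
  have := dpos hw
  rw [cc_eq hz hw]
  have : 0 ≤ 2*((z.re-w.re)^2+(z.im-w.im)^2)/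
      ((1 - (z.re^2+z.im^2)) * (1 - (w.re^2+w.im^2))) := by positivity
  linarith

lemma eq_of_cc {z w : ℂ} (hz : ‖z‖ < 1) (hw : ‖w‖ < 1) (h : cc z w = 1) : z = w := by
  have h1 := dpos hz
  have h2 := dpos hw
  rw [cc_eq hz hw] at h
  have h3 : 2*((z.re-w.re)^2+(z.im-w.im)^2)/
      ((1 - (z.re^2+z.im^2)) * (1 - (w.re^2+w.im^2))) = 0 := by linarith
  rw [div_eq_zero_iff] at h3
  rcases h3 with h3 | h3
  · apply Complex.ext <;> nlinarith [sq_nonneg (z.re-w.re), sq_nonneg (z.im-w.im)]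
  · exact absurd h3 (by positivity)

lemma cc_comm (z w : ℂ) : cc z w = cc w z := by unfold cc; ring

/-- numerator/denominator identity -/
lemma den_id (z w : ℂ) : ‖1 - (starRingEnd ℂ) w * z‖^2 =
    ‖z - w‖^2 + (1 - (z.re^2+z.im^2)) * (1 - (w.re^2+w.im^2)) := by
  rw [nsq, nsq]; simp; ring

lemma den_ne {z w : ℂ} (hz : ‖z‖ < 1) (hw : ‖w‖ < 1) : 1 - (starRingEnd ℂ) w * z ≠ 0 := by
  intro h
  have h0 := den_id z w
  rw [h] at h0
  have := mul_pos (dpos hz) (dpos hw)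
  have := sq_nonneg ‖z-w‖
  simp at h0
  linarith

lemma q_lt {z w : ℂ} (hz : ‖z‖ < 1) (hw : ‖w‖ < 1) :
    ‖(z - w) / (1 - (starRingEnd ℂ) w * z)‖ < 1 := by
  have h0 := den_id z w
  have := mul_pos (dpos hz) (dpos hw)
  have h1 := norm_pos_iff.2 (den_ne hz hw)
  rw [norm_div, div_lt_one h1]
  nlinarith [norm_nonneg (z-w)]

lemma cosh_artanh {q : ℝ} (h0 : 0 ≤ q) (h1 : q < 1) :
    Real.cosh (2 * artanh q) = (1+q^2)/(1-q^2) := by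
  have h2 : 0 < 1 - q := by linarith
  have h3 : 0 < (1+q)/(1-q) := by positivity
  have h4 : 1 - q^2 ≠ 0 := by nlinarith
  unfold artanh
  rw [mul_div_cancel₀ _ (two_ne_zero), Real.cosh_log h3]
  field_simp; ring

lemma artanh_nonneg {q : ℝ} (h0 : 0 ≤ q) (h1 : q < 1) : 0 ≤ artanh q := by
  unfold artanh
  have : 0 ≤ Real.log ((1 + q) / (1 - q)) := by
    apply Real.log_nonneg
    rw [le_div_iff₀ (by linarith)]; linarith
  linarith

lemma artanh_tanh (t : ℝ) : artanh (Real.tanh t) = t := by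
  unfold artanh
  rw [Real.tanh_eq_sinh_div_cosh]
  have hc := Real.cosh_pos t
  have : (1 + Real.sinh t / Real.cosh t) / (1 - Real.sinh t / Real.cosh t) = Real.exp (2*t) := by
    have h : Real.cosh t - Real.sinh t = Real.exp (-t) := Real.cosh_sub_sinh t
    have h' : Real.cosh t + Real.sinh t = Real.exp (t) := Real.cosh_add_sinh t
    have : (1 + Real.sinh t / Real.cosh t) / (1 - Real.sinh t / Real.cosh t) =
      (Real.cosh t + Real.sinh t)/(Real.cosh t - Real.sinh t) := by
      have : Real.cosh t - Real.sinh t ≠ 0 := by rw [h]; exact (Real.exp_pos _).ne'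
      field_simp
    rw [this, h, h', ← Real.exp_sub]; congr 1; ring
  rw [this, Real.log_exp]; ring

lemma pdist_nonneg {z w : ℂ} (hz : ‖z‖ < 1) (hw : ‖w‖ < 1) : 0 ≤ pdist z w :=
  artanh_nonneg (norm_nonneg _) (q_lt hz hw)

lemma cosh_pdist {z w : ℂ} (hz : ‖z‖ < 1) (hw : ‖w‖ < 1) :
    Real.cosh (2 * pdist z w) = cc z w := by
  unfold pdist
  rw [cosh_artanh (norm_nonneg _) (q_lt hz hw), cc_eq hz hw, norm_div, div_pow, den_id]
  have h1 := dpos hz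
  have h2 := dpos hw
  have h3 : ‖z-w‖^2 = (z.re-w.re)^2+(z.im-w.im)^2 := by rw [nsq]; simp
  rw [h3]
  set P := (1 - (z.re^2+z.im^2)) * (1 - (w.re^2+w.im^2)) with hP
  have hPp : 0 < P := mul_pos h1 h2
  set Q := (z.re-w.re)^2+(z.im-w.im)^2 with hQ
  have hQ0 : 0 ≤ Q := by positivity
  have h4 : Q + P ≠ 0 := by positivity
  have h5 : 1 - Q/(Q+P) = P/(Q+P) := by field_simp; ring
  rw [h5]
  field_simp; ring

lemma cosh_inj' {a b : ℝ} (ha : 0 ≤ a) (hb : 0 ≤ b) (h : Real.cosh a = Real.cosh b) : a = b := by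
  rcases lt_trichotomy a b with h1 | h1 | h1
  · have := Real.cosh_lt_cosh.2 (by rwa [abs_of_nonneg ha, abs_of_nonneg hb] : |a| < |b|)
    linarith
  · exact h1
  · have := Real.cosh_lt_cosh.2 (by rwa [abs_of_nonneg ha, abs_of_nonneg hb] : |b| < |a|)
    linarith

lemma pdist_eq_of_cc {z w z' w' : ℂ} (hz : ‖z‖ < 1) (hw : ‖w‖ < 1) (hz' : ‖z'‖ < 1)
    (hw' : ‖w'‖ < 1) (h : cc z w = cc z' w') : pdist z w = pdist z' w' := by
  rw [← cosh_pdist hz hw, ← cosh_pdist hz' hw'] at h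
  have := cosh_inj' (by linarith [pdist_nonneg hz hw]) (by linarith [pdist_nonneg hz' hw']) h
  linarith

lemma pdist_comm {z w : ℂ} (hz : ‖z‖ < 1) (hw : ‖w‖ < 1) : pdist z w = pdist w z :=
  pdist_eq_of_cc hz hw hw hz (cc_comm _ _)

lemma eq_of_pdist {z w : ℂ} (hz : ‖z‖ < 1) (hw : ‖w‖ < 1) (h : pdist z w = 0) : z = w := by
  apply eq_of_cc hz hw
  rw [← cosh_pdist hz hw, h]; simp

lemma pdist_self (z : ℂ) : pdist z z = 0 := by simp [pdist, artanh]

lemma gram {x u y : ℂ} (hx : ‖x‖ < 1) (hu : ‖u‖ < 1) (hy : ‖y‖ < 1) :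
    (cc x y - cc x u * cc u y)^2 ≤ (cc x u^2-1)*(cc u y^2-1) := by
  have h1 := n_rel hx
  have h2 := n_rel hu
  have h3 := n_rel hy
  have key : (nT x^2 - nA x^2 - nB x^2)*(nT u^2 - nA u^2 - nB u^2)*(nT y^2 - nA y^2 - nB y^2)
    + 2*cc x y*cc x u*cc u y - (nT x^2 - nA x^2 - nB x^2)*cc u y^2
    - (nT u^2 - nA u^2 - nB u^2)*cc x y^2 - (nT y^2 - nA y^2 - nB y^2)*cc x u^2
    = (nT x*(nA u*nB y-nB u*nA y) - nA x*(nT u*nB y-nB u*nT y)+nB x*(nT u*nA y-nA u*nT y))^2 := by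
    unfold cc; ring
  rw [h1,h2,h3] at key
  nlinarith [sq_nonneg (nT x*(nA u*nB y-nB u*nA y) - nA x*(nT u*nB y-nB u*nT y)+nB x*(nT u*nA y-nA u*nT y))]

lemma pdist_tri {x u y : ℂ} (hx : ‖x‖ < 1) (hu : ‖u‖ < 1) (hy : ‖y‖ < 1) :
    pdist x y ≤ pdist x u + pdist u y := by
  have h := gram hx hu hy
  rw [← cosh_pdist hx hu, ← cosh_pdist hx hy, ← cosh_pdist hu hy] at h
  have e1 := Real.cosh_sq (2*pdist x u)
  have e2 := Real.cosh_sq (2*pdist u y)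
  have n1 := pdist_nonneg hx hu
  have n2 := pdist_nonneg hu hy
  have n3 := pdist_nonneg hx hy
  have s1 : 0 ≤ Real.sinh (2*pdist x u) := Real.sinh_nonneg_iff.2 (by linarith)
  have s2 : 0 ≤ Real.sinh (2*pdist u y) := Real.sinh_nonneg_iff.2 (by linarith)
  have h' : (Real.cosh (2*pdist x y) - Real.cosh (2*pdist x u) * Real.cosh (2*pdist u y))^2
    ≤ (Real.sinh (2*pdist x u) * Real.sinh (2*pdist u y))^2 := by
    calc _ ≤ _ := h
      _ = _ := by rw [e1,e2]; ring
  have h2 := abs_le_of_sq_le_sq' h' (by positivity)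
  have h3 : Real.cosh (2*pdist x y) ≤ Real.cosh (2*pdist x u + 2*pdist u y) := by
    rw [Real.cosh_add]; linarith [h2.2]
  rw [Real.cosh_le_cosh, abs_of_nonneg (by linarith), abs_of_nonneg (by linarith)] at h3
  linarith

lemma exists_pt {T A B : ℝ} (hT : 0 < T) (h : T^2-A^2-B^2 = 1) :
    ∃ z : ℂ, ‖z‖ < 1 ∧ nT z = T ∧ nA z = A ∧ nB z = B := by
  have h1 : (0:ℝ) < 1+T := by linarith
  have e : (A/(1+T))^2+(B/(1+T))^2 = (T-1)/(1+T) := by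
    field_simp; nlinarith
  have e2 : 1 - (T-1)/(1+T) = 2/(1+T) := by field_simp; ring
  refine ⟨⟨A/(1+T), B/(1+T)⟩, disc_of ?_, ?_, ?_, ?_⟩
  · simp only [e]; rw [div_lt_one h1]; linarith
  · simp only [nT, e, e2]; field_simp; ring
  · simp only [nA, e, e2]; field_simp
  · simp only [nB, e, e2]; field_simp

lemma midpoint {x y : ℂ} (hx : ‖x‖ < 1) (hy : ‖y‖ < 1) :
    ∃ m : ℂ, ‖m‖ < 1 ∧ ∀ u : ℂ, cc u x + cc u y = 2 * cc u m * Real.cosh (pdist x y) := by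
  have h1 := n_rel hx
  have h2 := n_rel hy
  have hc := Real.cosh_pos (pdist x y)
  set c := Real.cosh (pdist x y) with hcd
  have h3 : cc x y = 2*c^2-1 := by
    rw [← cosh_pdist hx hy, Real.cosh_two_mul]
    have := Real.cosh_sq (pdist x y)
    rw [hcd]; linarith
  have hT : 0 < (nT x + nT y)/(2*c) := by
    have := nT_pos hx; have := nT_pos hy; positivity
  obtain ⟨m, hm, hT, hA, hB⟩ := exists_pt (A := (nA x + nA y)/(2*c)) (B := (nB x + nB y)/(2*c)) hT (by
    unfold cc at h3
    field_simp; nlinarith)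
  refine ⟨m, hm, fun u => ?_⟩
  unfold cc
  rw [hT,hA,hB]; field_simp; ring

/-- distance of the midpoint -/
lemma midpoint_dist {x y : ℂ} (hx : ‖x‖ < 1) (hy : ‖y‖ < 1) :
    ∃ m : ℂ, ‖m‖ < 1 ∧ (∀ u : ℂ, cc u x + cc u y = 2 * cc u m * Real.cosh (pdist x y)) ∧
      2 * pdist x m = pdist x y ∧ 2 * pdist m y = pdist x y := by
  obtain ⟨m, hm, h⟩ := midpoint hx hy
  have hc := Real.cosh_pos (pdist x y)
  have hs := Real.cosh_sq (pdist x y)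
  have n := pdist_nonneg hx hy
  have hxy := cosh_pdist hx hy
  rw [Real.cosh_two_mul] at hxy
  have self : ∀ z : ℂ, ‖z‖ < 1 → cc z z = 1 := fun z hz => by
    rw [← cosh_pdist hz hz, pdist_self]; simp
  refine ⟨m, hm, h, ?_, ?_⟩
  · refine cosh_inj' (by linarith [pdist_nonneg hx hm]) n ?_
    have := h x
    rw [self x hx] at this
    rw [cosh_pdist hx hm]
    apply mul_right_cancel₀ hc.ne'
    nlinarith
  · refine cosh_inj' (by linarith [pdist_nonneg hm hy]) n ?_
    have := h y
    rw [self y hy, cc_comm y x] at this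
    rw [cosh_pdist hm hy, cc_comm]
    apply mul_right_cancel₀ hc.ne'
    nlinarith

lemma midpoint_unique {x y m : ℂ} (hx : ‖x‖ < 1) (hy : ‖y‖ < 1) (hm : ‖m‖ < 1)
    (h1 : 2 * pdist x m = pdist x y) (h2 : 2 * pdist m y = pdist x y) (u : ℂ) :
    cc u x + cc u y = 2 * cc u m * Real.cosh (pdist x y) := by
  obtain ⟨m', hm', h⟩ := midpoint hx hy
  have hc := Real.cosh_pos (pdist x y)
  have := h m
  rw [← cosh_pdist hm hy, h2, cc_comm m x, ← cosh_pdist hx hm, h1] at this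
  have h3 : cc m m' = 1 := by
    apply mul_right_cancel₀ hc.ne'
    linarith
  rw [eq_of_cc hm hm' h3]
  exact h u

/-- Moebius translation -/
def mo (P z : ℂ) : ℂ := (z + P) / (1 + (starRingEnd ℂ) P * z)

lemma mo_den {P z : ℂ} (hP : ‖P‖ < 1) (hz : ‖z‖ < 1) : 1 + (starRingEnd ℂ) P * z ≠ 0 := by
  have := den_ne (z := z) (w := -P) hz (by simpa using hP)
  simpa using this

lemma mo_mem {P z : ℂ} (hP : ‖P‖ < 1) (hz : ‖z‖ < 1) : ‖mo P z‖ < 1 := by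
  have := q_lt (z := z) (w := -P) hz (by simpa using hP)
  simpa [mo] using this

lemma mo_inv {P z : ℂ} (hP : ‖P‖ < 1) (hz : ‖z‖ < 1) : mo P (mo (-P) z) = z := by
  have h1 := mo_den (P := -P) (by simpa using hP) hz
  have h2 := mo_den hP (mo_mem (P := -P) (by simpa using hP) hz)
  unfold mo at *
  rw [div_eq_iff h2]
  simp only [map_neg] at *
  obtain ⟨D, hD⟩ : ∃ D, D = 1 + -(starRingEnd ℂ) P * z := ⟨_, rfl⟩
  rw [← hD] at h1 ⊢
  field_simp
  rw [hD]
  ring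

lemma mo_alg {P p z w v : ℂ} (h1 : 1 + p * z ≠ 0) (h2 : 1 + p * w ≠ 0) (h3 : 1 + P * v ≠ 0)
    (h4 : 1 - v * z ≠ 0) (h5 : 1 - p * P ≠ 0) :
    ((z + P) / (1 + p * z) - (w + P) / (1 + p * w)) /
      (1 - (v + p) / (1 + P * v) * ((z + P) / (1 + p * z))) =
    (z - w) / (1 - v * z) * ((1 + P * v) / (1 + p * w)) := by
  obtain ⟨D1, hD1⟩ : ∃ D, D = 1 + p * z := ⟨_, rfl⟩
  obtain ⟨D2, hD2⟩ : ∃ D, D = 1 + p * w := ⟨_, rfl⟩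
  obtain ⟨D3, hD3⟩ : ∃ D, D = 1 + P * v := ⟨_, rfl⟩
  obtain ⟨D4, hD4⟩ : ∃ D, D = 1 - v * z := ⟨_, rfl⟩
  obtain ⟨D5, hD5⟩ : ∃ D, D = 1 - p * P := ⟨_, rfl⟩
  rw [← hD1] at h1
  rw [← hD2] at h2
  rw [← hD3] at h3
  rw [← hD4] at h4
  rw [← hD5] at h5
  rw [← hD1, ← hD2, ← hD3, ← hD4]
  have e1 : (z + P) / D1 - (w + P) / D2 = (z-w)*D5/(D1*D2) := by
    field_simp; rw [hD1, hD2, hD5]; ring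
  have e2 : 1 - (v + p) / D3 * ((z + P) / D1) = D4*D5/(D3*D1) := by
    field_simp; rw [hD1, hD3, hD4, hD5]; ring
  rw [e1, e2]; field_simp

lemma mo_pdist {P z w : ℂ} (hP : ‖P‖ < 1) (hz : ‖z‖ < 1) (hw : ‖w‖ < 1) :
    pdist (mo P z) (mo P w) = pdist z w := by
  unfold pdist
  congr 1
  have h1 := mo_den hP hz
  have h2 := mo_den hP hw
  have h3 : 1 + P * (starRingEnd ℂ) w ≠ 0 := by
    intro h
    apply h2
    have := congrArg (starRingEnd ℂ) h
    simpa using this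
  have h4 := den_ne hz hw
  have h5 : 1 - (starRingEnd ℂ) P * P ≠ 0 := den_ne hP hP
  have hk : (mo P z - mo P w) / (1 - (starRingEnd ℂ) (mo P w) * mo P z)
     = (z-w)/(1 - (starRingEnd ℂ) w * z) * ((1 + P * (starRingEnd ℂ) w)/(1 + (starRingEnd ℂ) P * w)) := by
    unfold mo
    simp only [map_div₀, map_add, map_one, map_mul, Complex.conj_conj]
    generalize (starRingEnd ℂ) P = p at *
    generalize (starRingEnd ℂ) w = v at *
    exact mo_alg h1 h2 h3 h4 h5
  rw [hk, norm_mul]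
  have : ‖(1 + P * (starRingEnd ℂ) w)/(1 + (starRingEnd ℂ) P * w)‖ = 1 := by
    rw [norm_div]
    have : ‖1 + P * (starRingEnd ℂ) w‖ = ‖1 + (starRingEnd ℂ) P * w‖ := by
      rw [← Complex.norm_conj]; simp
    rw [this, div_self (norm_ne_zero_iff.2 h2)]
  rw [this, mul_one]

structure Good (L : ℝ) (g : ℂ → ℂ) : Prop where
  mem : ∀ z, ‖z‖ < 1 → ‖g z‖ < 1
  lip : ∀ x y, ‖x‖ < 1 → ‖y‖ < 1 → pdist (g x) (g y) ≤ L * pdist x y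
  geo : ∀ x u y, ‖x‖ < 1 → ‖u‖ < 1 → ‖y‖ < 1 → pdist x y = pdist x u + pdist u y →
    pdist (g x) (g u) * pdist u y = pdist (g u) (g y) * pdist x u

lemma Good.comp {L : ℝ} {g : ℂ → ℂ} (h : Good L g) {P : ℂ} (hP : ‖P‖ < 1) :
    Good L (fun z => g (mo P z)) where
  mem z hz := h.mem _ (mo_mem hP hz)
  lip x y hx hy := by
    rw [← mo_pdist hP hx hy]; exact h.lip _ _ (mo_mem hP hx) (mo_mem hP hy)
  geo x u y hx hu hy e := by
    rw [← mo_pdist hP hx hy, ← mo_pdist hP hx hu, ← mo_pdist hP hu hy] at e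
    rw [← mo_pdist hP hx hu, ← mo_pdist hP hu hy]
    exact h.geo _ _ _ (mo_mem hP hx) (mo_mem hP hu) (mo_mem hP hy) e

lemma vec_eq {p : ℕ} {a b c : Fin p → ℝ} {al be : ℝ} (hal : 0 ≤ al) (hbe : 0 ≤ be)
    (hc : ∀ j, 0 ≤ c j) (hab : ∀ j, c j ≤ a j + b j)
    (h1 : ∑ j, a j^2 = al^2) (h2 : ∑ j, b j^2 = be^2) (h3 : ∑ j, c j^2 = (al+be)^2) (j : Fin p) :
    be * a j = al * b j := by
  have h4 : ∑ j, c j^2 ≤ ∑ j, (a j + b j)^2 :=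
    Finset.sum_le_sum fun j _ => pow_le_pow_left₀ (hc j) (hab j) 2
  have h5 : ∑ j, (a j + b j)^2 = al^2 + be^2 + 2 * ∑ j, a j * b j := by
    rw [← h1, ← h2, Finset.mul_sum, ← Finset.sum_add_distrib, ← Finset.sum_add_distrib]
    exact Finset.sum_congr rfl fun j _ => by ring
  have h6 : ∑ j, (be * a j - al * b j)^2 = be^2 * al^2 + al^2*be^2 - 2*(al*be) * ∑ j, a j * b j := by
    conv_rhs => rw [← h1]
    conv_rhs => enter [1,2]; rw [h1, ← h2]
    rw [Finset.mul_sum, Finset.mul_sum, Finset.mul_sum, ← Finset.sum_add_distrib, ← Finset.sum_sub_distrib]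
    exact Finset.sum_congr rfl fun j _ => by ring
  have h7 : al * be ≤ ∑ j, a j * b j := by nlinarith
  have h8 : ∑ j, (be * a j - al * b j)^2 ≤ 0 := by
    rw [h6]; nlinarith [mul_nonneg hal hbe]
  have h9 := Finset.single_le_sum (f := fun j => (be * a j - al * b j)^2)
    (fun j _ => sq_nonneg _) (Finset.mem_univ j)
  have : (be * a j - al * b j)^2 ≤ 0 := h9.trans h8
  nlinarith

lemma good_of_iso {p : ℕ} {lam : ℝ} (hlam : 0 < lam) {f : Fin p → ℂ → ℂ}
    (hmap : ∀ j, ∀ z ∈ unitDisc, f j z ∈ unitDisc)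
    (hiso : ∀ z ∈ unitDisc, ∀ w ∈ unitDisc,
      ∑ j, (pdist (f j z) (f j w))^2 = (Real.sqrt lam * pdist z w)^2) (j : Fin p) :
    Good (Real.sqrt lam) (f j) where
  mem := hmap j
  lip x y hx hy := by
    have h9 := Finset.single_le_sum (f := fun j => (pdist (f j x) (f j y))^2)
      (fun j _ => sq_nonneg _) (Finset.mem_univ j)
    rw [hiso x hx y hy] at h9
    exact le_of_sq_le_sq h9 (mul_nonneg (Real.sqrt_nonneg _) (pdist_nonneg hx hy))
  geo x u y hx hu hy e := by
    have hs := Real.sqrt_pos.2 hlam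
    have := vec_eq (a := fun j => pdist (f j x) (f j u)) (b := fun j => pdist (f j u) (f j y))
      (c := fun j => pdist (f j x) (f j y)) (mul_nonneg hs.le (pdist_nonneg hx hu))
      (mul_nonneg hs.le (pdist_nonneg hu hy)) (fun j => pdist_nonneg (hmap j x hx) (hmap j y hy))
      (fun j => pdist_tri (hmap j x hx) (hmap j u hu) (hmap j y hy))
      (hiso x hx u hu) (hiso u hu y hy) (by rw [hiso x hx y hy, e]; ring) j
    apply mul_left_cancel₀ hs.ne'
    linarith

/-- point at distance `t` from `0` in direction `e` -/
def pt (e : ℂ) (t : ℝ) : ℂ := (Real.tanh t : ℂ) * e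

lemma pt_norm {e : ℂ} (he : ‖e‖ = 1) {t : ℝ} (ht : 0 ≤ t) : ‖pt e t‖ = Real.tanh t := by
  unfold pt
  rw [norm_mul, he, mul_one, Complex.norm_real, Real.norm_eq_abs, abs_of_nonneg]
  rw [Real.tanh_eq_sinh_div_cosh]
  exact div_nonneg (Real.sinh_nonneg_iff.2 ht) (Real.cosh_pos t).le

lemma pt_mem {e : ℂ} (he : ‖e‖ = 1) {t : ℝ} (ht : 0 ≤ t) : ‖pt e t‖ < 1 := by
  rw [pt_norm he ht]; exact Real.tanh_lt_one t

lemma pdist_zero (z : ℂ) : pdist z 0 = artanh ‖z‖ := by simp [pdist]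

lemma zmem : ‖(0:ℂ)‖ < 1 := by simp

lemma pdist_pt {e : ℂ} (he : ‖e‖ = 1) {t : ℝ} (ht : 0 ≤ t) : pdist (pt e t) 0 = t := by
  rw [pdist_zero, pt_norm he ht, artanh_tanh]

lemma cc_pt {e e' : ℂ} (he : ‖e‖ = 1) (he' : ‖e'‖ = 1) (t s : ℝ) :
    cc (pt e t) (pt e' s) = Real.cosh (2*t) * Real.cosh (2*s)
      - Real.sinh (2*t) * Real.sinh (2*s) * (e.re*e'.re+e.im*e'.im) := by
  have h : e.re^2+e.im^2 = 1 := by rw [← nsq, he]; norm_num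
  have h' : e'.re^2+e'.im^2 = 1 := by rw [← nsq, he']; norm_num
  have aux : ∀ (e : ℂ) (t : ℝ), e.re^2+e.im^2 = 1 →
     nT (pt e t) = Real.cosh (2*t) ∧ nA (pt e t) = Real.sinh (2*t) * e.re ∧
     nB (pt e t) = Real.sinh (2*t) * e.im := by
    intro e t h
    have r : (pt e t).re = Real.tanh t * e.re := by unfold pt; rw [Complex.re_ofReal_mul]
    have i : (pt e t).im = Real.tanh t * e.im := by unfold pt; rw [Complex.im_ofReal_mul]
    have hc := Real.cosh_pos t
    have hs := Real.cosh_sq t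
    have s1 : (Real.tanh t * e.re)^2 + (Real.tanh t * e.im)^2 = Real.sinh t^2/Real.cosh t^2 := by
      rw [Real.tanh_eq_sinh_div_cosh]
      calc _ = (Real.sinh t/Real.cosh t)^2 * (e.re^2+e.im^2) := by ring
        _ = _ := by rw [h, mul_one, div_pow]
    have s2 : 1 - Real.sinh t^2/Real.cosh t^2 = 1/Real.cosh t^2 := by
      field_simp; linarith
    unfold nT nA nB
    rw [r, i, s1, s2, Real.cosh_two_mul, Real.sinh_two_mul, Real.tanh_eq_sinh_div_cosh]
    refine ⟨?_, ?_, ?_⟩ <;> field_simp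
  obtain ⟨a1, a2, a3⟩ := aux e t h
  obtain ⟨b1, b2, b3⟩ := aux e' s h'
  unfold cc
  rw [a1,a2,a3,b1,b2,b3]; ring

lemma pdist_opp {e : ℂ} (he : ‖e‖ = 1) {t s : ℝ} (ht : 0 ≤ t) (hs : 0 ≤ s) :
    pdist (pt e t) (pt (-e) s) = t + s := by
  have he' : ‖-e‖ = 1 := by simpa using he
  have h : e.re^2+e.im^2 = 1 := by rw [← nsq, he]; norm_num
  have h1 := cc_pt he he' t s
  rw [← cosh_pdist (pt_mem he ht) (pt_mem he' hs)] at h1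
  have h2 : e.re * (-e).re + e.im * (-e).im = -1 := by simp; linarith
  rw [h2, mul_neg, mul_one, sub_neg_eq_add, ← Real.cosh_add] at h1
  have := cosh_inj' (by linarith [pdist_nonneg (pt_mem he ht) (pt_mem he' hs)]) (by linarith) h1
  linarith

lemma exists_polar {z : ℂ} (hz : ‖z‖ < 1) : ∃ e : ℂ, ‖e‖ = 1 ∧ ∃ t, 0 ≤ t ∧ z = pt e t := by
  have key : Real.tanh (pdist z 0) = ‖z‖ := by
    rw [pdist_zero]; unfold artanh
    have h2 : 0 < 1 - ‖z‖ := by linarith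
    have h0 := norm_nonneg z
    have h3 : 0 < (1+‖z‖)/(1-‖z‖) := by positivity
    set L := Real.log ((1+‖z‖)/(1-‖z‖)) / 2 with hL
    have e : Real.exp L ^2 = (1+‖z‖)/(1-‖z‖) := by
      rw [← Real.exp_log h3, ← Real.exp_nat_mul]; congr 1; rw [hL]; push_cast; ring
    rw [Real.tanh_eq_sinh_div_cosh, Real.sinh_eq, Real.cosh_eq, Real.exp_neg]
    have hp := Real.exp_pos L
    set E := Real.exp L
    have : (E - E⁻¹)/2 / ((E+E⁻¹)/2) = (E^2-1)/(E^2+1) := by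
      field_simp
    rw [this, e]
    field_simp; ring
  by_cases h : z = 0
  · exact ⟨1, by simp, 0, le_rfl, by simp [pt, h]⟩
  · refine ⟨z/‖z‖, ?_, pdist z 0, pdist_nonneg hz zmem, ?_⟩
    · rw [norm_div, Complex.norm_real, norm_norm, div_self (norm_ne_zero_iff.2 h)]
    · unfold pt; rw [key]
      have : (‖z‖:ℂ) ≠ 0 := by exact_mod_cast norm_ne_zero_iff.2 h
      field_simp

section
variable {L : ℝ} {g : ℂ → ℂ}

lemma Good.ray (h : Good L g) {e : ℂ} (he : ‖e‖ = 1) {t : ℝ} (ht : 0 ≤ t) :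
    pdist (g (pt e t)) (g 0) = pdist (g (pt e 1)) (g 0) * t := by
  have he' : ‖-e‖ = 1 := by simpa using he
  have main : ∀ s t, 0 ≤ s → 0 ≤ t →
      pdist (g (pt e s)) (g 0) * t = pdist (g (pt (-e) t)) (g 0) * s := by
    intro s t hs ht
    have e1 := pdist_opp he hs ht
    have e2 := pdist_pt he hs
    have e3 := pdist_pt he' ht
    rw [pdist_comm (pt_mem he' ht) zmem] at e3
    have := h.geo _ _ _ (pt_mem he hs) zmem (pt_mem he' ht) (by rw [e1,e2,e3])
    rw [e2, e3, pdist_comm (h.mem _ zmem) (h.mem _ (pt_mem he' ht))] at this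
    exact this
  have a := main t 1 ht zero_le_one
  have b := main 1 1 zero_le_one zero_le_one
  rw [mul_one] at a b
  rw [a, b, mul_one]

lemma Good.bound (h : Good L g) (hL : 0 ≤ L) {e e' : ℂ} (he : ‖e‖ = 1) (he' : ‖e'‖ = 1) (hne : e ≠ e') :
    pdist (g (pt e 1)) (g 0) ≤ pdist (g (pt e' 1)) (g 0) := by
  by_contra hlt
  push Not at hlt
  set s := pdist (g (pt e 1)) (g 0) with hs
  set s' := pdist (g (pt e' 1)) (g 0) with hs'
  have q1 : e.re^2+e.im^2 = 1 := by rw [← nsq, he]; norm_num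
  have q2 : e'.re^2+e'.im^2 = 1 := by rw [← nsq, he']; norm_num
  set k2 := (1 - (e.re*e'.re+e.im*e'.im))/2 with hk2
  have hkk : 4*k2 = (e.re-e'.re)^2 + (e.im-e'.im)^2 := by rw [hk2]; nlinarith
  have hk : 0 < k2 := by
    have : 0 ≤ k2 := by nlinarith [sq_nonneg (e.re-e'.re), sq_nonneg (e.im-e'.im)]
    rcases this.lt_or_eq with h | h
    · exact h
    · exfalso; apply hne
      rw [← h] at hkk
      apply Complex.ext <;> nlinarith [sq_nonneg (e.re-e'.re), sq_nonneg (e.im-e'.im)]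
  have hk1 : k2 ≤ 1 := by
    rw [hk2]; nlinarith [sq_nonneg (e.re+e'.re), sq_nonneg (e.im+e'.im)]
  have kb : ∀ t, 0 ≤ t → (s - s') * t ≤ L * (1/k2) := by
    intro t ht
    have hx := pt_mem he ht
    have hy := pt_mem he' ht
    obtain ⟨m, hm, hmid, d1, d2⟩ := midpoint_dist hx hy
    set D := pdist (pt e t) (pt e' t) with hD
    have hD0 : 0 ≤ D := pdist_nonneg hx hy
    have hcD := Real.cosh_pos D
    have c1 : Real.cosh D^2 = 1 + k2 * Real.sinh (2*t)^2 := by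
      have := cosh_pdist hx hy
      rw [cc_pt he he', ← hD, Real.cosh_two_mul] at this
      have h1 := Real.cosh_sq D
      have h2 := Real.cosh_sq (2*t)
      have h3 : e.re*e'.re+e.im*e'.im = 1 - 2*k2 := by rw [hk2]; ring
      rw [h3] at this
      nlinarith
    have c2 : k2 * Real.cosh (2*t) ≤ Real.cosh D := by
      have h2 := Real.cosh_sq (2*t)
      have hc := Real.cosh_pos (2*t)
      apply le_of_sq_le_sq _ hcD.le
      rw [c1, mul_pow, h2]
      nlinarith [sq_nonneg (Real.sinh (2*t)), mul_nonneg hk.le (sub_nonneg.2 hk1)]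
    have c3 : Real.cosh (2*pdist m 0) ≤ 1/k2 := by
      have := hmid 0
      rw [cc_comm, ← cosh_pdist hx zmem, cc_comm, ← cosh_pdist hy zmem, cc_comm, ← cosh_pdist hm zmem,
        pdist_pt he ht, pdist_pt he' ht] at this
      rw [le_div_iff₀ hk]
      apply le_of_mul_le_mul_right _ hcD
      nlinarith
    have c4 : 2 * pdist m 0 ≤ 1/k2 := by
      have := Real.self_le_sinh_iff.2 (show 0 ≤ 2*pdist m 0 by linarith [pdist_nonneg hm zmem])
      have := Real.sinh_lt_cosh (2*pdist m 0)
      linarith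
    have gx := h.mem _ hx
    have gy := h.mem _ hy
    have gm := h.mem _ hm
    have g0 := h.mem _ zmem
    have c5 : pdist (g (pt e t)) (g m) = pdist (g m) (g (pt e' t)) ∨ D = 0 := by
      have := h.geo _ _ _ hx hm hy (by rw [← hD]; linarith)
      by_cases h0 : D = 0
      · exact Or.inr h0
      · left
        have e1 : pdist (pt e t) m = D/2 := by linarith
        have e2 : pdist m (pt e' t) = D/2 := by linarith
        rw [e1, e2] at this
        exact mul_right_cancel₀ (by positivity) this
    have r1 := h.ray he ht
    have r2 := h.ray he' ht
    have l := h.lip _ _ hm zmem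
    have l2 : L * (2 * pdist m 0) ≤ L * (1/k2) := mul_le_mul_of_nonneg_left c4 hL
    rcases c5 with c5 | c5
    · have t1 := pdist_tri gx gm g0
      have t2 := pdist_tri gm g0 gy
      have t3 := pdist_tri gm g0 gy
      have t4 := pdist_comm g0 gy
      rw [← hs] at r1
      rw [← hs'] at r2
      linarith
    · have := eq_of_pdist hx hy c5
      rw [this, r2] at r1
      have : 0 ≤ L * (1/k2) := by positivity
      linarith
  have := kb ((L*(1/k2) + 1)/(s-s')) (by
    have : 0 < s - s' := by linarith
    positivity)
  rw [mul_div_cancel₀ _ (by linarith)] at this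
  linarith

lemma Good.base0 (h : Good L g) (hL : 0 ≤ L) : ∃ c, 0 ≤ c ∧ ∀ z, ‖z‖ < 1 → pdist (g z) (g 0) = c * pdist z 0 := by
  have h1 : ‖(1:ℂ)‖ = 1 := by simp
  refine ⟨pdist (g (pt 1 1)) (g 0), pdist_nonneg (h.mem _ (pt_mem h1 zero_le_one)) (h.mem _ zmem), fun z hz => ?_⟩
  obtain ⟨e, he, t, ht, rfl⟩ := exists_polar hz
  rw [pdist_pt he ht, h.ray he ht]
  congr 1
  by_cases hne : e = 1
  · rw [hne]
  · exact le_antisymm (h.bound hL he h1 hne) (h.bound hL h1 he (Ne.symm hne))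

lemma mo_zero (P : ℂ) : mo P 0 = P := by simp [mo]

lemma Good.base (h : Good L g) (hL : 0 ≤ L) {P : ℂ} (hP : ‖P‖ < 1) :
    ∃ c, 0 ≤ c ∧ ∀ z, ‖z‖ < 1 → pdist (g z) (g P) = c * pdist z P := by
  obtain ⟨c, hc, H⟩ := (h.comp hP).base0 hL
  refine ⟨c, hc, fun z hz => ?_⟩
  have hP' : ‖-P‖ < 1 := by simpa using hP
  have hm := mo_mem hP' hz
  have := H _ hm
  rw [mo_inv hP hz, mo_zero] at this
  rw [this, ← mo_pdist hP hm zmem, mo_inv hP hz, mo_zero]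

lemma Good.homothety (h : Good L g) (hL : 0 ≤ L) :
    ∃ c, 0 ≤ c ∧ ∀ z w, ‖z‖ < 1 → ‖w‖ < 1 → pdist (g z) (g w) = c * pdist z w := by
  obtain ⟨c, hc, H⟩ := h.base0 hL
  have H' : ∀ z w, ‖z‖ < 1 → ‖w‖ < 1 → w ≠ 0 → pdist (g z) (g w) = c * pdist z w := by
    intro z w hz hw hw0
    obtain ⟨c', hc', H'⟩ := h.base hL hw
    have a := H' 0 zmem
    rw [pdist_comm (h.mem _ zmem) (h.mem _ hw), H w hw, pdist_comm zmem hw] at a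
    have : c = c' := mul_right_cancel₀ (fun h0 => hw0 (eq_of_pdist hw zmem h0)) a
    rw [this]; exact H' z hz
  refine ⟨c, hc, fun z w hz hw => ?_⟩
  by_cases hw0 : w = 0
  · rw [hw0]; exact H z hz
  · exact H' z w hz hw hw0

lemma lim_aux {a : ℝ → ℝ} (h0 : ∀ t, 0 ≤ t → 0 ≤ a t)
    (h : ∀ t, 0 ≤ t → Real.cosh (2 * a t) = Real.cosh (2*t)^2) :
    Tendsto (fun t => 2 * a t - 4 * t) atTop (nhds (Real.log (1/2))) := by
  have hE : Tendsto (fun t => Real.exp (2 * a t - 4 * t)) atTop (nhds (1/2)) := by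
    have l0 : Tendsto (fun t : ℝ => Real.exp (-(4*t))) atTop (nhds 0) :=
      Real.tendsto_exp_neg_atTop_nhds_zero.comp (tendsto_id.const_mul_atTop (by norm_num : (0:ℝ) < 4))
    have l1 : Tendsto (fun t : ℝ => Real.exp (-(8*t))) atTop (nhds 0) :=
      Real.tendsto_exp_neg_atTop_nhds_zero.comp (tendsto_id.const_mul_atTop (by norm_num : (0:ℝ) < 8))
    have l2 : Tendsto (fun t : ℝ => Real.exp (-(2*a t) - 4*t)) atTop (nhds 0) := by
      refine tendsto_of_tendsto_of_tendsto_of_le_of_le' tendsto_const_nhds l0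
        (Eventually.of_forall fun t => (Real.exp_pos _).le) ?_
      filter_upwards [eventually_ge_atTop 0] with t ht
      apply Real.exp_le_exp.2; linarith [h0 t ht]
    have l3 : Tendsto (fun t : ℝ => 1/2 + Real.exp (-(4*t)) + Real.exp (-(8*t))/2 - Real.exp (-(2*a t) - 4*t))
      atTop (nhds (1/2 + 0 + 0/2 - 0)) := (((tendsto_const_nhds).add l0).add (l1.div_const 2)).sub l2
    have e : (1/2 + 0 + 0/2 - 0 : ℝ) = 1/2 := by norm_num
    rw [e] at l3
    refine l3.congr' ?_
    filter_upwards [eventually_ge_atTop 0] with t ht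
    have := h t ht
    rw [Real.cosh_eq, Real.cosh_eq] at this
    have x1 : Real.exp (2*a t - 4*t) = Real.exp (2*a t) * Real.exp (-(4*t)) := by
      rw [← Real.exp_add]; congr 1
    have x2 : Real.exp (-(2*a t) - 4*t) = Real.exp (-(2*a t)) * Real.exp (-(4*t)) := by
      rw [← Real.exp_add]; congr 1
    have x3 : Real.exp (-(4*t)) = Real.exp (-(2*t))^2 := by
      rw [← Real.exp_nat_mul]; congr 1; push_cast; ring
    have x4 : Real.exp (-(8*t)) = Real.exp (-(2*t))^4 := by
      rw [← Real.exp_nat_mul]; congr 1; push_cast; ring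
    have x5 : Real.exp (2*t) * Real.exp (-(2*t)) = 1 := by
      rw [← Real.exp_add]; simp
    rw [x1, x2, x3, x4]
    set X := Real.exp (2*t)
    set Y := Real.exp (-(2*t))
    have : Real.exp (2*a t) = (X+Y)^2/2 - Real.exp (-(2*a t)) := by linarith
    rw [this]
    have y1 : X^2*Y^2 = 1 := by rw [← mul_pow, x5]; norm_num
    have y2 : X*Y*Y^2 = Y^2 := by rw [x5]; ring
    linear_combination (-1/2)*y1 - y2
  have := hE.log (by norm_num)
  simpa using this

lemma homothety_one {c : ℝ} (hc : 0 < c) (hm : ∀ z, ‖z‖ < 1 → ‖g z‖ < 1)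
    (H : ∀ z w, ‖z‖ < 1 → ‖w‖ < 1 → pdist (g z) (g w) = c * pdist z w) : c = 1 := by
  have h1 : ‖(1:ℂ)‖ = 1 := by simp
  have h1' : ‖(-1:ℂ)‖ = 1 := by simp
  have hI : ‖Complex.I‖ = 1 := by simp
  set a : ℝ → ℝ := fun t => pdist (pt Complex.I t) (pt 1 t) with ha
  have a0 : ∀ t, 0 ≤ t → 0 ≤ a t := fun t ht => pdist_nonneg (pt_mem hI ht) (pt_mem h1 ht)
  have a1 : ∀ t, 0 ≤ t → Real.cosh (2 * a t) = Real.cosh (2*t)^2 := by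
    intro t ht
    rw [ha]; simp only
    rw [cosh_pdist (pt_mem hI ht) (pt_mem h1 ht), cc_pt hI h1]; simp; ring
  have a1' : ∀ t, 0 ≤ t → pdist (pt Complex.I t) (pt (-1) t) = a t := by
    intro t ht
    apply pdist_eq_of_cc (pt_mem hI ht) (pt_mem h1' ht) (pt_mem hI ht) (pt_mem h1 ht)
    rw [cc_pt hI h1, cc_pt hI h1']; simp
  have a2 : ∀ t, 0 ≤ t → Real.cosh (2 * (c * a t)) = Real.cosh (2*(c*t))^2 := by
    intro t ht
    have mx := pt_mem h1 ht
    have my := pt_mem h1' ht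
    have mu := pt_mem hI ht
    have dxy : pdist (pt 1 t) (pt (-1) t) = t + t := pdist_opp h1 ht ht
    have dx := pdist_pt h1 ht
    have dy := pdist_pt h1' ht
    rw [pdist_comm my zmem] at dy
    have := midpoint_unique (hm _ mx) (hm _ my) (hm _ zmem) (by
      rw [H _ _ mx zmem, H _ _ mx my, dx, dxy]; ring) (by
      rw [H _ _ zmem my, H _ _ mx my, dy, dxy]; ring) (g (pt Complex.I t))
    rw [← cosh_pdist (hm _ mu) (hm _ mx), ← cosh_pdist (hm _ mu) (hm _ my),
      ← cosh_pdist (hm _ mu) (hm _ zmem), H _ _ mu mx, H _ _ mu my, H _ _ mu zmem, H _ _ mx my,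
      a1' t ht, pdist_pt hI ht, dxy] at this
    have e : c * (t+t) = 2*(c*t) := by ring
    rw [e] at this
    simp only [ha]
    simp only [ha] at this
    linarith
  have a3 : ∀ t, 0 ≤ t → a (c*t) = c * a t := by
    intro t ht
    have := (a1 (c*t) (by positivity)).trans (a2 t ht).symm
    have := cosh_inj' (by linarith [a0 (c*t) (by positivity)]) (by
      have := mul_nonneg hc.le (a0 t ht); linarith) this
    linarith
  have L1 := lim_aux a0 a1
  have L2 := L1.comp (tendsto_id.const_mul_atTop hc)
  have L3 := L1.const_mul c
  have L4 : Tendsto (fun t => c * (2 * a t - 4 * t)) atTop (nhds (Real.log (1/2))) := by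
    refine L2.congr' ?_
    filter_upwards [eventually_ge_atTop 0] with t ht
    simp only [Function.comp, id]
    rw [a3 t ht]; ring
  have := tendsto_nhds_unique L3 L4
  have hl : Real.log (1/2) ≠ 0 := (Real.log_neg (by norm_num) (by norm_num)).ne
  exact mul_right_cancel₀ hl (by rw [this, one_mul])

end

lemma iso_fix0 {h : ℂ → ℂ} (hm : ∀ z, ‖z‖ < 1 → ‖h z‖ < 1) (h0 : h 0 = 0)
    (H : ∀ z w, ‖z‖ < 1 → ‖w‖ < 1 → pdist (h z) (h w) = pdist z w) :
    ∃ u : ℂ, ‖u‖ = 1 ∧ ((∀ z, ‖z‖ < 1 → h z = u * z) ∨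
      (∀ z, ‖z‖ < 1 → h z = u * (starRingEnd ℂ) z)) := by
  have hcc : ∀ z w, ‖z‖ < 1 → ‖w‖ < 1 → cc (h z) (h w) = cc z w := by
    intro z w hz hw
    rw [← cosh_pdist (hm z hz) (hm w hw), H z w hz hw, cosh_pdist hz hw]
  have hn : ∀ z, ‖z‖ < 1 → (h z).re^2+(h z).im^2 = z.re^2+z.im^2 := by
    intro z hz
    have := hcc z 0 hz zmem
    have d1 := dpos hz
    have d2 := dpos (hm z hz)
    rw [h0] at this
    simp only [cc, nT, nA, nB, Complex.zero_re, Complex.zero_im] at this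
    norm_num at this
    rw [div_eq_div_iff d2.ne' d1.ne'] at this
    linarith
  have hi : ∀ z w, ‖z‖ < 1 → ‖w‖ < 1 →
      (h z).re*(h w).re+(h z).im*(h w).im = z.re*w.re+z.im*w.im := by
    intro z w hz hw
    have := hcc z w hz hw
    have d1 := dpos hz
    have d2 := dpos hw
    have n1 := hn z hz
    have n2 := hn w hw
    rw [cc_eq (hm z hz) (hm w hw), cc_eq hz hw, n1, n2, add_right_inj,
      div_left_inj' (mul_pos d1 d2).ne'] at this
    linarith
  have m1 : ‖((1/2 : ℝ) : ℂ)‖ < 1 := by rw [Complex.norm_real]; norm_num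
  have m2 : ‖(⟨0, 1/2⟩ : ℂ)‖ < 1 := disc_of (by norm_num)
  set p := h ((1/2 : ℝ) : ℂ) with hp
  set q := h (⟨0, 1/2⟩ : ℂ) with hq
  have p1 : p.re^2+p.im^2 = 1/4 := by
    have := hn _ m1
    rw [← hp, Complex.ofReal_re, Complex.ofReal_im] at this; rw [this]; norm_num
  have q1 : q.re^2+q.im^2 = 1/4 := by
    have := hn _ m2
    rw [← hq] at this; rw [this]; norm_num
  have pq : p.re*q.re+p.im*q.im = 0 := by
    have := hi _ _ m1 m2
    rw [← hp, ← hq, Complex.ofReal_re, Complex.ofReal_im] at this; rw [this]; norm_num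
  have hP : ∀ z, ‖z‖ < 1 → p.re*(h z).re + p.im*(h z).im = z.re/2 := by
    intro z hz
    have := hi _ _ m1 hz
    rw [← hp, Complex.ofReal_re, Complex.ofReal_im] at this; rw [this]; ring
  have hQ : ∀ z, ‖z‖ < 1 → q.re*(h z).re + q.im*(h z).im = z.im/2 := by
    intro z hz
    have := hi _ _ m2 hz
    rw [← hq] at this; rw [this]; ring
  set ε := 4*(p.re*q.im-p.im*q.re) with hε
  have ce : q.re = -ε*p.im := by
    rw [hε]; linear_combination (-4*q.re)*p1 + 4*p.re*pq
  have de : q.im = ε*p.re := by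
    rw [hε]; linear_combination (-4*q.im)*p1 + 4*p.im*pq
  have hε2 : (ε-1)*(ε+1) = 0 := by
    rw [ce, de] at q1
    linear_combination 4*q1 - 4*ε^2*p1
  have hW : ∀ z, ‖z‖ < 1 → ε*(p.re*(h z).im - p.im*(h z).re) = z.im/2 := by
    intro z hz
    have := hQ z hz
    rw [ce, de] at this
    linarith
  refine ⟨2*p, ?_, ?_⟩
  · have : ‖2*p‖^2 = 1 := by
      rw [norm_mul, mul_pow, nsq p, p1]; norm_num
    nlinarith [norm_nonneg (2*p)]
  · rcases mul_eq_zero.1 hε2 with e | e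
    · left
      intro z hz
      have e1 := hP z hz
      have e2 := hW z hz
      have : ε = 1 := by linarith
      rw [this] at e2
      apply Complex.ext
      · simp
        linear_combination (-4*(h z).re)*p1 + 4*p.re*e1 - 4*p.im*e2
      · simp
        linear_combination (-4*(h z).im)*p1 + 4*p.im*e1 + 4*p.re*e2
    · right
      intro z hz
      have e1 := hP z hz
      have e2 := hW z hz
      have : ε = -1 := by linarith
      rw [this] at e2
      apply Complex.ext
      · simp
        linear_combination (-4*(h z).re)*p1 + 4*p.re*e1 + 4*p.im*e2
      · simp
        linear_combination (-4*(h z).im)*p1 + 4*p.im*e1 - 4*p.re*e2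

lemma mob_of {g : ℂ → ℂ} {u b : ℂ} (hu : ‖u‖ = 1) (hb : ‖b‖ < 1)
    (h : ∀ z, ‖z‖ < 1 → g z = mo b (u*z)) : IsMobiusOn g := by
  obtain ⟨θ, hθ⟩ := (Complex.norm_eq_one_iff u).1 hu
  have huu : (starRingEnd ℂ) u * u = 1 := by
    rw [mul_comm, Complex.mul_conj, Complex.normSq_eq_norm_sq, hu]; norm_num
  refine ⟨θ, -((starRingEnd ℂ) u * b), ?_, fun z hz => ?_⟩
  · rw [norm_neg, norm_mul, Complex.norm_conj, hu, one_mul]; exact hb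
  · rw [h z hz, hθ]
    unfold mo
    simp only [map_neg, map_mul, Complex.conj_conj]
    rw [← mul_div_assoc]
    congr 1
    · linear_combination (-b) * huu
    · ring

lemma iso_mobius {g : ℂ → ℂ} (hm : ∀ z, ‖z‖ < 1 → ‖g z‖ < 1)
    (H : ∀ z w, ‖z‖ < 1 → ‖w‖ < 1 → pdist (g z) (g w) = pdist z w) :
    IsMobiusOn g ∨ IsMobiusOn (fun z => (starRingEnd ℂ) (g z)) := by
  have hb := hm 0 zmem
  set b := g 0 with hbd
  have hb' : ‖-b‖ < 1 := by simpa using hb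
  obtain ⟨u, hu, h⟩ := iso_fix0 (h := fun z => mo (-b) (g z)) (fun z hz => mo_mem hb' (hm z hz))
    (by simp [mo, ← hbd]) (fun z w hz hw => by rw [mo_pdist hb' (hm z hz) (hm w hw), H z w hz hw])
  rcases h with h | h
  · left
    refine mob_of hu hb fun z hz => ?_
    rw [← h z hz, mo_inv hb (hm z hz)]
  · right
    refine mob_of (u := (starRingEnd ℂ) u) (b := (starRingEnd ℂ) b) (by simpa using hu)
      (by simpa using hb) fun z hz => ?_
    have := mo_inv hb (hm z hz)
    rw [h z hz] at this
    rw [← this]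
    simp [mo]

end TG

/-- **Theorem 1.1** (target a polydisc). A `C²`-smooth totally geodesic isometric embedding
`f : (Δ, λ g_Δ) → (Δ^p, g_{Δ^p})` which extends `C¹` over an open boundary arc with nowhere
vanishing radial derivative has `λ` components that are Möbius automorphisms or conjugates
thereof, the remaining components being constant. -/
theorem totally_geodesic_disc_in_polydisc_boundary
    (p : ℕ) (hp : 0 < p) (lam : ℝ) (hlam : 0 < lam)
    (f : Fin p → ℂ → ℂ)
    (hmap : ∀ j, ∀ z ∈ unitDisc, f j z ∈ unitDisc)
    (hC2 : ∀ j, ContDiffOn ℝ 2 (f j) unitDisc)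
    (hiso : ∀ z ∈ unitDisc, ∀ w ∈ unitDisc,
      polyDist p (fun j => f j z) (fun j => f j w) = Real.sqrt lam * pdist z w)
    (U : Set ℂ) (hU : U ⊆ unitCircle) (hUne : U.Nonempty)
    (hUopen : ∃ V : Set ℂ, IsOpen V ∧ U = V ∩ unitCircle)
    (hC1 : ∀ j, ContDiffOn ℝ 1 (f j) (unitDisc ∪ U))
    (hrad : ∀ q ∈ U, ∃ j, fderivWithin ℝ (f j) (unitDisc ∪ U) q q ≠ 0) :
    ∃ k : ℕ, 0 < k ∧ (lam : ℝ) = (k : ℝ) ∧ k ≤ p ∧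
      ∃ S : Finset (Fin p), S.card = k ∧
        (∀ j ∈ S, IsMobiusOn (f j) ∨ IsMobiusOn (fun z => (starRingEnd ℂ) (f j z))) ∧
        (∀ j ∉ S, ∃ c : ℂ, ∀ z ∈ unitDisc, f j z = c) := by
  classical
  have hsum : ∀ z ∈ unitDisc, ∀ w ∈ unitDisc,
      ∑ j, (pdist (f j z) (f j w))^2 = (Real.sqrt lam * pdist z w)^2 := by
    intro z hz w hw
    rw [← hiso z hz w hw, polyDist, Real.sq_sqrt (Finset.sum_nonneg fun j _ => sq_nonneg _)]
  have key : ∀ j, ∃ c : ℝ, (c = 0 ∨ c = 1) ∧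
      ∀ z w, ‖z‖ < 1 → ‖w‖ < 1 → pdist (f j z) (f j w) = c * pdist z w := by
    intro j
    have hg := TG.good_of_iso hlam hmap hsum j
    obtain ⟨c, hc, H⟩ := hg.homothety (Real.sqrt_nonneg _)
    refine ⟨c, ?_, H⟩
    rcases hc.lt_or_eq with h | h
    · exact Or.inr (TG.homothety_one h hg.mem H)
    · exact Or.inl h.symm
  choose c hc H using key
  set S : Finset (Fin p) := Finset.univ.filter (fun j => c j = 1) with hS
  have m1 : ‖((1/2 : ℝ) : ℂ)‖ < 1 := by rw [Complex.norm_real]; norm_num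
  have hcard : lam = (S.card : ℝ) := by
    have h1 := hsum _ m1 0 TG.zmem
    have hd : pdist ((1/2 : ℝ) : ℂ) 0 ≠ 0 := by
      intro h
      have := TG.eq_of_pdist m1 TG.zmem h
      norm_num at this
    have h2 : ∑ j, (pdist (f j ((1/2 : ℝ) : ℂ)) (f j 0))^2 =
        (S.card : ℝ) * (pdist ((1/2 : ℝ) : ℂ) 0)^2 := by
      rw [hS, Finset.card_filter, Nat.cast_sum, Finset.sum_mul]
      refine Finset.sum_congr rfl fun j _ => ?_
      rw [H j _ _ m1 TG.zmem]
      rcases hc j with h | h <;> rw [h] <;> simp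
    rw [h2, mul_pow, Real.sq_sqrt hlam.le] at h1
    exact (mul_right_cancel₀ (pow_ne_zero 2 hd) h1).symm
  refine ⟨S.card, ?_, hcard, ?_, S, rfl, fun j hj => ?_, fun j hj => ?_⟩
  · rw [hcard] at hlam; exact_mod_cast hlam
  · simpa using Finset.card_le_univ S
  · have : c j = 1 := by simpa [hS] using hj
    refine TG.iso_mobius (hmap j) fun z w hz hw => ?_
    rw [H j z w hz hw, this, one_mul]
  · have : c j = 0 := (hc j).resolve_right (by simpa [hS] using hj)
    refine ⟨f j 0, fun z hz => ?_⟩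
    refine TG.eq_of_pdist (hmap j z hz) (hmap j 0 TG.zmem) ?_
    rw [H j z 0 hz TG.zmem, this, zero_mul]
end
end

section
/- Let f : D → D be a C²-smooth map such that for every complete geodesic γ of (D, ρ) (i.e., every γ : ℝ → D with ρ(γ(s), γ(t)) = c|s − t| for all s, t and some c > 0), the composition f ∘ γ is again a complete geodesic of (D, ρ) with some positive constant speed. Suppose f(0) = 0, f extends C¹-smoothly to D ∪ U for some open arc U ⊂ ∂D containing 1, f(1) = 1, and the radial derivative of f at 1 is nonzero. Then f(x) = x for every x ∈ (−1, 1). -/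
open Complex Metric Set Filter

noncomputable section

lemma aux_one_sub_tanh (t : ℝ) :
    1 - Real.tanh t = 2 * Real.exp (-(2 * t)) / (1 + Real.exp (-(2 * t))) := by
  have h1 : Real.exp (-(2 * t)) = Real.exp (-t) * Real.exp (-t) := by
    rw [← Real.exp_add]; congr 1; ring
  have h2 : Real.exp t * Real.exp (-t) = 1 := by rw [← Real.exp_add]; simp
  have hp := Real.exp_pos t
  have hq := Real.exp_pos (-t)
  rw [Real.tanh_eq_sinh_div_cosh, Real.sinh_eq, Real.cosh_eq, h1]
  generalize Real.exp t = p at *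
  generalize Real.exp (-t) = q at *
  have : p + q ≠ 0 := by positivity
  have : 1 + q * q ≠ 0 := by positivity
  field_simp
  linear_combination (-2 * q) * h2

lemma aux_tanh_sub (a b : ℝ) :
    Real.tanh (a - b) = (Real.tanh a - Real.tanh b) / (1 - Real.tanh a * Real.tanh b) := by
  have ha := (Real.cosh_pos a).ne'
  have hb := (Real.cosh_pos b).ne'
  have hab := (Real.cosh_pos (a - b)).ne'
  rw [Real.cosh_sub] at hab
  rw [Real.tanh_eq_sinh_div_cosh, Real.tanh_eq_sinh_div_cosh, Real.tanh_eq_sinh_div_cosh,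
    Real.sinh_sub, Real.cosh_sub]
  have h : 1 - Real.sinh a / Real.cosh a * (Real.sinh b / Real.cosh b)
    = (Real.cosh a * Real.cosh b - Real.sinh a * Real.sinh b) / (Real.cosh a * Real.cosh b) := by
    field_simp
  rw [h]
  field_simp

lemma aux_abs_tanh (a : ℝ) : |Real.tanh a| = Real.tanh |a| := by
  have key : ∀ x : ℝ, 0 ≤ x → 0 ≤ Real.tanh x := fun x hx => by
    rw [Real.tanh_eq_sinh_div_cosh]
    exact div_nonneg (Real.sinh_nonneg_iff.2 hx) (Real.cosh_pos x).le
  rcases le_total 0 a with h | h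
  · rw [abs_of_nonneg h, abs_of_nonneg (key a h)]
  · have := key (-a) (by linarith)
    rw [abs_of_nonpos h, Real.tanh_neg, abs_of_nonpos]
    rw [Real.tanh_neg] at this; linarith

lemma aux_artanh_eq {x : ℝ} (h0 : 0 ≤ x) (h1 : x < 1) : artanh x = Real.artanh x := by
  rw [Real.artanh_eq_half_log ⟨by linarith, h1.le⟩, artanh]; ring

lemma aux_pdist_tanh (s t : ℝ) :
    pdist (Real.tanh s : ℂ) (Real.tanh t : ℂ) = 1 * |s - t| := by
  have e : ‖((Real.tanh s : ℂ) - (Real.tanh t : ℂ)) /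
      (1 - (starRingEnd ℂ) (Real.tanh t : ℂ) * (Real.tanh s : ℂ))‖ = Real.tanh |s - t| := by
    rw [← aux_abs_tanh, aux_tanh_sub, Complex.conj_ofReal, ← Real.norm_eq_abs, ← Complex.norm_real]
    push_cast
    rw [mul_comm]
  rw [pdist, e, aux_artanh_eq, Real.artanh_tanh, one_mul]
  · rw [← aux_abs_tanh]; positivity
  · exact Real.tanh_lt_one _

lemma aux_normSq_id (z w : ℂ) :
    ‖z - w‖ ^ 2 = ‖1 - (starRingEnd ℂ) w * z‖ ^ 2 - (1 - ‖z‖ ^ 2) * (1 - ‖w‖ ^ 2) := by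
  simp only [← Complex.normSq_eq_norm_sq, Complex.normSq_apply]
  simp
  ring

lemma aux_pdist_imp {z w : ℂ} (hz : ‖z‖ < 1) (hw : ‖w‖ < 1) {a : ℝ} (h : pdist z w = a) :
    0 < ‖1 - (starRingEnd ℂ) w * z‖ ∧
    ‖z - w‖ / ‖1 - (starRingEnd ℂ) w * z‖ = Real.tanh a := by
  have hpos : 0 < ‖1 - (starRingEnd ℂ) w * z‖ := by
    have h2 : ‖(starRingEnd ℂ) w * z‖ < 1 := by
      rw [norm_mul, Complex.norm_conj]
      nlinarith [norm_nonneg z, norm_nonneg w]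
    have := norm_sub_norm_le (1 : ℂ) ((starRingEnd ℂ) w * z)
    rw [norm_one] at this
    linarith
  refine ⟨hpos, ?_⟩
  have hid := aux_normSq_id z w
  have hlt : ‖z - w‖ / ‖1 - (starRingEnd ℂ) w * z‖ < 1 := by
    rw [div_lt_one hpos]
    have : 0 < (1 - ‖z‖ ^ 2) * (1 - ‖w‖ ^ 2) := by
      apply mul_pos <;> nlinarith [norm_nonneg z, norm_nonneg w]
    apply lt_of_pow_lt_pow_left₀ 2 hpos.le
    linarith
  have h0 : 0 ≤ ‖z - w‖ / ‖1 - (starRingEnd ℂ) w * z‖ := by positivity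
  rw [pdist, norm_div, aux_artanh_eq h0 hlt] at h
  rw [← h, Real.tanh_artanh ⟨by linarith, hlt⟩]

lemma aux_key {z w : ℂ} {a b : ℝ} (hz : ‖z‖ = |Real.tanh a|) (hw : ‖w‖ = |Real.tanh b|)
    (h : pdist z w = |a - b|) :
    ‖1 - (starRingEnd ℂ) w * z‖ ^ 2 = (1 - Real.tanh a * Real.tanh b) ^ 2 := by
  have hta := Real.tanh_lt_one a
  have htb := Real.tanh_lt_one b
  have hta' := Real.neg_one_lt_tanh a
  have htb' := Real.neg_one_lt_tanh b
  obtain ⟨hp, he⟩ := aux_pdist_imp (by rw [hz, abs_lt]; exact ⟨hta', hta⟩)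
    (by rw [hw, abs_lt]; exact ⟨htb', htb⟩) h
  have hid := aux_normSq_id z w
  rw [← aux_abs_tanh, aux_tanh_sub] at he
  have he2 := congrArg (· ^ 2) he
  simp only [sq_abs, div_pow] at he2
  rw [hid, hz, hw, sq_abs, sq_abs] at he2
  generalize Real.tanh a = u at *
  generalize Real.tanh b = v at *
  have hQ : 0 < 1 - u * v := by nlinarith
  have hP : 0 < (1 - u ^ 2) * (1 - v ^ 2) := by apply mul_pos <;> nlinarith
  rw [div_eq_div_iff (by positivity) (by positivity)] at he2
  have : (1 - u ^ 2) * (1 - v ^ 2) * ‖1 - (starRingEnd ℂ) w * z‖ ^ 2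
      = (1 - u ^ 2) * (1 - v ^ 2) * (1 - u * v) ^ 2 := by
    linear_combination he2
  exact mul_left_cancel₀ hP.ne' this

lemma aux_exp_tendsto {c : ℝ} (hc : 0 < c) :
    Tendsto (fun t : ℝ => Real.exp (-(2 * (c * t)))) atTop (nhds 0) := by
  apply Real.tendsto_exp_neg_atTop_nhds_zero.comp
  exact (tendsto_id.const_mul_atTop hc).const_mul_atTop two_pos

lemma aux_tanh_tendsto {c : ℝ} (hc : 0 < c) :
    Tendsto (fun t : ℝ => Real.tanh (c * t)) atTop (nhds 1) := by
  have h := aux_exp_tendsto hc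
  have h2 : Tendsto (fun t : ℝ => 1 - 2 * Real.exp (-(2 * (c * t))) /
      (1 + Real.exp (-(2 * (c * t))))) atTop (nhds (1 - 2 * 0 / (1 + 0))) :=
    tendsto_const_nhds.sub ((h.const_mul 2).div (tendsto_const_nhds.add h) (by norm_num))
  simp only [← aux_one_sub_tanh] at h2
  simpa using h2

lemma aux_speed {c L : ℝ} (hc : 0 < c) (hL : 0 < L)
    (h : Tendsto (fun t : ℝ => (1 - Real.tanh (c * t)) / (1 - Real.tanh t)) atTop (nhds L)) :
    c = 1 := by
  have h1 := aux_exp_tendsto hc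
  have h2 := aux_exp_tendsto one_pos
  simp only [one_mul] at h2
  have h3 := h.mul ((tendsto_const_nhds (x := (1 : ℝ))).add h1)
  have h4 := h3.div ((tendsto_const_nhds (x := (1 : ℝ))).add h2) (by norm_num)
  have e : ∀ t : ℝ, (1 - Real.tanh (c * t)) / (1 - Real.tanh t) *
      (1 + Real.exp (-(2 * (c * t)))) / (1 + Real.exp (-(2 * t)))
      = Real.exp (2 * (1 - c) * t) := by
    intro t
    rw [aux_one_sub_tanh, aux_one_sub_tanh]
    have p1 := Real.exp_pos (-(2 * (c * t)))
    have p2 := Real.exp_pos (-(2 * t))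
    have p3 : 1 + Real.exp (-(2 * (c * t))) ≠ 0 := by positivity
    have p4 : 1 + Real.exp (-(2 * t)) ≠ 0 := by positivity
    field_simp
    rw [← Real.exp_add]; congr 1; ring
  have h5 : Tendsto (fun t : ℝ => Real.exp (2 * (1 - c) * t)) atTop (nhds L) := by
    have : L * (1 + 0) / (1 + 0) = L := by norm_num
    rw [this] at h4
    exact h4.congr e
  have h6 := (Real.continuousAt_log hL.ne').tendsto.comp h5
  have h7 := h6.div_atTop tendsto_id
  have h8 : Tendsto (fun _ : ℝ => 2 * (1 - c)) atTop (nhds 0) := by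
    refine h7.congr' ?_
    filter_upwards [eventually_gt_atTop 0] with t ht
    simp [Real.log_exp, ht.ne']
  have := tendsto_nhds_unique h8 tendsto_const_nhds
  linarith

/-- Key step in the proof of Lemma 3.1: a geodesic-preserving self-map of the disc fixing `0`
and `1`, with nondegenerate radial derivative at `1`, is the identity on `(-1, 1)`. -/
theorem geodesic_preserving_fixes_real_axis
    (f : ℂ → ℂ) (hmap : Set.MapsTo f unitDisc unitDisc)
    (hC2 : ContDiffOn ℝ 2 f unitDisc)
    (hgeo : ∀ γ : ℝ → ℂ, (∀ t, γ t ∈ unitDisc) →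
      (∃ c > 0, ∀ s t : ℝ, pdist (γ s) (γ t) = c * |s - t|) →
      (∃ c' > 0, ∀ s t : ℝ, pdist (f (γ s)) (f (γ t)) = c' * |s - t|))
    (hf0 : f 0 = 0)
    (U : Set ℂ) (hU : U ⊆ unitCircle) (h1U : (1 : ℂ) ∈ U)
    (hUopen : ∃ V : Set ℂ, IsOpen V ∧ U = V ∩ unitCircle)
    (hC1 : ContDiffOn ℝ 1 f (unitDisc ∪ U))
    (hf1 : f 1 = 1)
    (hrad : fderivWithin ℝ f (unitDisc ∪ U) 1 1 ≠ 0) :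
    ∀ x : ℝ, -1 < x → x < 1 → f x = (x : ℂ) := by
  have hmem : ∀ t : ℝ, ((Real.tanh t : ℝ) : ℂ) ∈ unitDisc := fun t => by
    show ‖((Real.tanh t : ℝ) : ℂ)‖ < 1
    rw [Complex.norm_real, Real.norm_eq_abs, abs_lt]
    exact ⟨Real.neg_one_lt_tanh t, Real.tanh_lt_one t⟩
  obtain ⟨c, hc, hg⟩ := hgeo (fun t => ((Real.tanh t : ℝ) : ℂ)) hmem
    ⟨1, one_pos, aux_pdist_tanh⟩
  have hfm : ∀ t : ℝ, ‖f (Real.tanh t : ℝ)‖ < 1 := fun t => hmap (hmem t)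
  have hnorm : ∀ t : ℝ, ‖f (Real.tanh t : ℝ)‖ = |Real.tanh (c * t)| := fun t => by
    have h := hg t 0
    simp only [Real.tanh_zero, Complex.ofReal_zero, hf0, sub_zero] at h
    have h2 := (aux_pdist_imp (hfm t) (by simp) h).2
    simp only [sub_zero, map_zero, zero_mul, norm_one, div_one] at h2
    rw [h2, aux_abs_tanh, abs_mul, abs_of_pos hc]
  have ht1 : Tendsto (fun t : ℝ => Real.tanh t) atTop (nhds 1) := by
    simpa using aux_tanh_tendsto one_pos
  have h1S : (1 : ℂ) ∈ unitDisc ∪ U := Or.inr h1U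
  have hd : DifferentiableWithinAt ℝ f (unitDisc ∪ U) 1 :=
    (hC1.differentiableOn one_ne_zero) 1 h1S
  have htS : Tendsto (fun t : ℝ => ((Real.tanh t : ℝ) : ℂ)) atTop
      (nhdsWithin 1 (unitDisc ∪ U)) := by
    rw [tendsto_nhdsWithin_iff]
    refine ⟨?_, Eventually.of_forall fun t => Or.inl (hmem t)⟩
    have := (Complex.continuous_ofReal.tendsto (1 : ℝ)).comp ht1
    rwa [Complex.ofReal_one] at this
  have hlim : Tendsto (fun t : ℝ => f (Real.tanh t : ℝ)) atTop (nhds 1) := by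
    have := hd.continuousWithinAt.tendsto.comp htS
    rwa [hf1] at this
  have hval : ∀ t : ℝ, f (Real.tanh t : ℝ) = ((Real.tanh (c * t) : ℝ) : ℂ) := fun t => by
    set z := f (Real.tanh t : ℝ) with hz
    have hk : ∀ s : ℝ, ‖1 - (starRingEnd ℂ) (f (Real.tanh s : ℝ)) * z‖ ^ 2 =
        (1 - Real.tanh (c * t) * Real.tanh (c * s)) ^ 2 := fun s => by
      refine (aux_key (hnorm t) (hnorm s) ?_)
      rw [← mul_sub, abs_mul, abs_of_pos hc]
      exact hg t s
    have hA : Tendsto (fun s : ℝ => ‖1 - (starRingEnd ℂ) (f (Real.tanh s : ℝ)) * z‖ ^ 2) atTop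
        (nhds (‖1 - (starRingEnd ℂ) 1 * z‖ ^ 2)) :=
      (tendsto_const_nhds.sub
        (((Complex.continuous_conj.tendsto 1).comp hlim).mul_const z)).norm.pow 2
    have hB : Tendsto (fun s : ℝ => (1 - Real.tanh (c * t) * Real.tanh (c * s)) ^ 2) atTop
        (nhds ((1 - Real.tanh (c * t) * 1) ^ 2)) :=
      (tendsto_const_nhds.sub ((aux_tanh_tendsto hc).const_mul _)).pow 2
    have hE := tendsto_nhds_unique (hA.congr hk) hB
    have hN : ‖z‖ ^ 2 = Real.tanh (c * t) ^ 2 := by rw [hnorm t, sq_abs]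
    rw [map_one, one_mul, mul_one] at hE
    rw [← Complex.normSq_eq_norm_sq, Complex.normSq_apply] at hE hN
    simp only [Complex.sub_re, Complex.sub_im, Complex.one_re, Complex.one_im] at hE
    have hre : z.re = Real.tanh (c * t) := by linarith
    have him : z.im = 0 := by
      rw [hre] at hN
      have : z.im * z.im = 0 := by linarith
      simpa using this
    apply Complex.ext
    · rw [Complex.ofReal_re, hre]
    · rw [Complex.ofReal_im, him]
  have hder : HasDerivWithinAt (fun x : ℝ => f x)
      (fderivWithin ℝ f (unitDisc ∪ U) 1 1) (Ioo (-1) 1) 1 := by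
    have ho : HasDerivWithinAt (fun x : ℝ => (x : ℂ)) 1 (Ioo (-1) 1) 1 :=
      Complex.ofRealCLM.hasDerivAt.hasDerivWithinAt
    refine HasFDerivWithinAt.comp_hasDerivWithinAt_of_eq (y := (1 : ℂ)) (1 : ℝ)
      hd.hasFDerivWithinAt ho ?_ (by simp)
    intro x hx
    left
    show ‖(x : ℂ)‖ < 1
    rw [Complex.norm_real, Real.norm_eq_abs, abs_lt]
    exact hx
  rw [hasDerivWithinAt_iff_tendsto_slope' (by simp)] at hder
  have htI : Tendsto (fun t : ℝ => Real.tanh t) atTop (nhdsWithin 1 (Ioo (-1) 1)) := by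
    rw [tendsto_nhdsWithin_iff]
    exact ⟨ht1, Eventually.of_forall fun t => ⟨Real.neg_one_lt_tanh t, Real.tanh_lt_one t⟩⟩
  have hsl := (hder.comp htI).norm
  have hc1 : c = 1 := by
    refine aux_speed hc (norm_pos_iff.2 hrad) (hsl.congr fun t => ?_)
    have l1 := Real.tanh_lt_one t
    have l2 := Real.tanh_lt_one (c * t)
    simp only [Function.comp, slope_def_module, hval, Complex.ofReal_one, hf1, norm_smul]
    rw [← Complex.ofReal_one, ← Complex.ofReal_sub, Complex.norm_real, norm_inv,
      Real.norm_eq_abs, Real.norm_eq_abs, abs_of_neg (by linarith), abs_of_neg (by linarith),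
      neg_sub, neg_sub, div_eq_inv_mul]
  intro x hx1 hx2
  have h := hval (Real.artanh x)
  rwa [hc1, one_mul, Real.tanh_artanh ⟨hx1, hx2⟩] at h
end
end
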